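/- Let the compound primitive relay channel have a compact convex state set Q ⊆ P(S), and suppose the channel is reversely strongly degraded. Then the deterministic code capacity, R_DF(Q), and R_CS(Q) all coincide and equal min_{q∈Q} max_{p(x)} I_q(X;Y). -/

import Mathlib

open scoped BigOperators ENNReal

noncomputable section

/-- `p` is a probability mass function on a finite type. -/
def IsPMF {α : Type} [Fintype α] (p : α → ℝ) : Prop :=
  (∀ a, 0 ≤ p a) ∧ ∑ a, p a = 1

/-- `W` is a channel: each `W x s` is a pmf on the output alphabet. -/
def IsChannel {𝒳 𝒮 𝒵 : Type} [Fintype 𝒵] (W : 𝒳 → 𝒮 → 𝒵 → ℝ) : Prop :=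
  ∀ x s, IsPMF (W x s)

/-- Shannon entropy (base 2). By the convention `log₂ 0 = 0` in Mathlib, terms with
`p a = 0` contribute `0`. -/
def ent {α : Type} [Fintype α] (p : α → ℝ) : ℝ :=
  -∑ a, p a * Real.logb 2 (p a)

/-- Mutual information of a joint pmf on a product of finite types. -/
def mutInfo {α β : Type} [Fintype α] [Fintype β] (p : α × β → ℝ) : ℝ :=
  ent (fun a => ∑ b, p (a, b)) + ent (fun b => ∑ a, p (a, b)) - ent p

/-- Conditional mutual information `I(X;Y|U)` of a joint pmf on `U × X × Y`,
via `I(X;Y|U) = H(U,X) + H(U,Y) − H(U,X,Y) − H(U)`. -/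
def condMutInfo {υ α β : Type} [Fintype υ] [Fintype α] [Fintype β]
    (p : υ × α × β → ℝ) : ℝ :=
  ent (fun ua : υ × α => ∑ b, p (ua.1, ua.2, b))
    + ent (fun ub : υ × β => ∑ a, p (ub.1, a, ub.2))
    - ent p
    - ent (fun u : υ => ∑ a, ∑ b, p (u, a, b))

section InfoQuantities

variable {𝒳 𝒮 𝒴 𝒴₁ : Type} [Fintype 𝒳] [Fintype 𝒮] [Fintype 𝒴] [Fintype 𝒴₁]

/-- `I_q(X;Y)` under input pmf `p(x)`, state pmf `q(s)` and channel `W`. -/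
def IqXY (W : 𝒳 → 𝒮 → 𝒴 × 𝒴₁ → ℝ) (p : 𝒳 → ℝ) (q : 𝒮 → ℝ) : ℝ :=
  mutInfo (fun xy : 𝒳 × 𝒴 => p xy.1 * ∑ s, q s * ∑ y1, W xy.1 s (xy.2, y1))

/-- `I_q(X;Y,Y₁)`. -/
def IqXYY1 (W : 𝒳 → 𝒮 → 𝒴 × 𝒴₁ → ℝ) (p : 𝒳 → ℝ) (q : 𝒮 → ℝ) : ℝ :=
  mutInfo (fun xz : 𝒳 × (𝒴 × 𝒴₁) => p xz.1 * ∑ s, q s * W xz.1 s xz.2)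

/-- `I_q(U;Y)` under input pmf `p(u,x)` (auxiliary alphabet `Fin k`). -/
def IqUY {k : ℕ} (W : 𝒳 → 𝒮 → 𝒴 × 𝒴₁ → ℝ) (p : Fin k × 𝒳 → ℝ) (q : 𝒮 → ℝ) : ℝ :=
  mutInfo (fun uy : Fin k × 𝒴 => ∑ x, ∑ s, ∑ y1, p (uy.1, x) * q s * W x s (uy.2, y1))

/-- `I_q(U;Y₁)` under input pmf `p(u,x)`. -/
def IqUY1 {k : ℕ} (W : 𝒳 → 𝒮 → 𝒴 × 𝒴₁ → ℝ) (p : Fin k × 𝒳 → ℝ) (q : 𝒮 → ℝ) : ℝ :=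
  mutInfo (fun uy : Fin k × 𝒴₁ => ∑ x, ∑ s, ∑ y, p (uy.1, x) * q s * W x s (y, uy.2))

/-- `I_q(X;Y|U)` under input pmf `p(u,x)`. -/
def IqXYgivenU {k : ℕ} (W : 𝒳 → 𝒮 → 𝒴 × 𝒴₁ → ℝ) (p : Fin k × 𝒳 → ℝ) (q : 𝒮 → ℝ) : ℝ :=
  condMutInfo (fun uxy : Fin k × 𝒳 × 𝒴 =>
    p (uxy.1, uxy.2.1) * ∑ s, q s * ∑ y1, W uxy.2.1 s (uxy.2.2, y1))

/-- The partial decode-forward lower bound `R_DF(Q)`: the supremum over all finite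
auxiliary alphabets (represented by `Fin k`) and input pmfs `p(u,x)` of
`min{ inf_q I_q(U;Y) + inf_q I_q(X;Y|U) + C₁, inf_q I_q(U;Y₁) + inf_q I_q(X;Y|U) }`. -/
def RDF (W : 𝒳 → 𝒮 → 𝒴 × 𝒴₁ → ℝ) (C1 : ℝ) (Q : Set (𝒮 → ℝ)) : ℝ :=
  sSup {r | ∃ (k : ℕ) (p : Fin k × 𝒳 → ℝ), IsPMF p ∧
    r = min
      (sInf {v | ∃ q ∈ Q, v = IqUY W p q} + sInf {v | ∃ q ∈ Q, v = IqXYgivenU W p q} + C1)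
      (sInf {v | ∃ q ∈ Q, v = IqUY1 W p q} + sInf {v | ∃ q ∈ Q, v = IqXYgivenU W p q})}

/-- The cutset upper bound
`R_CS(Q) = inf_{q∈Q} max_{p(x)} min{ I_q(X;Y) + C₁, I_q(X;Y,Y₁) }`. -/
def RCS (W : 𝒳 → 𝒮 → 𝒴 × 𝒴₁ → ℝ) (C1 : ℝ) (Q : Set (𝒮 → ℝ)) : ℝ :=
  sInf {r | ∃ q ∈ Q, r = sSup {v | ∃ p : 𝒳 → ℝ, IsPMF p ∧
    v = min (IqXY W p q + C1) (IqXYY1 W p q)}}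

end InfoQuantities

/-- A deterministic code for the primitive relay channel: a message encoder, a relay
function mapping the relay's received block to one of `L` indices sent over the
noiseless link, and a decoder using the channel output together with that index. -/
structure PCode (𝒳 𝒴 𝒴₁ : Type) (n M L : ℕ) where
  f : Fin M → Fin n → 𝒳
  f1 : (Fin n → 𝒴₁) → Fin L
  g : (Fin n → 𝒴) × Fin L → Fin M

/-- The noiseless link of rate `C₁` supports `L` indices when `L ≤ 2^{nC₁}`. -/
def LinkOK (n L : ℕ) (C1 : ℝ) : Prop := 1 ≤ L ∧ (L : ℝ) ≤ (2 : ℝ) ^ ((n : ℝ) * C1)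

section Codes

variable {𝒳 𝒮 𝒴 𝒴₁ : Type} [Fintype 𝒳] [Fintype 𝒮] [Fintype 𝒴] [Fintype 𝒴₁]
variable {n M L : ℕ}

/-- Conditional probability of error of the code given the state sequence `s`. -/
def PCode.errGiven (C : PCode 𝒳 𝒴 𝒴₁ n M L) (W : 𝒳 → 𝒮 → 𝒴 × 𝒴₁ → ℝ)
    (s : Fin n → 𝒮) : ℝ :=
  (M : ℝ)⁻¹ * ∑ m : Fin M, ∑ y : Fin n → 𝒴, ∑ y1 : Fin n → 𝒴₁,
    if C.g (y, C.f1 y1) = m then 0 else ∏ i, W (C.f m i) (s i) (y i, y1 i)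

/-- Average error probability under an i.i.d. state distribution `q`. -/
def PCode.errIID (C : PCode 𝒳 𝒴 𝒴₁ n M L) (W : 𝒳 → 𝒮 → 𝒴 × 𝒴₁ → ℝ)
    (q : 𝒮 → ℝ) : ℝ :=
  ∑ s : Fin n → 𝒮, (∏ i, q (s i)) * C.errGiven W s

/-- Average error probability under an arbitrary joint state distribution `qn`. -/
def PCode.errJoint (C : PCode 𝒳 𝒴 𝒴₁ n M L) (W : 𝒳 → 𝒮 → 𝒴 × 𝒴₁ → ℝ)
    (qn : (Fin n → 𝒮) → ℝ) : ℝ :=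
  ∑ s : Fin n → 𝒮, qn s * C.errGiven W s

end Codes

section Capacities

variable {𝒳 𝒮 𝒴 𝒴₁ : Type} [Fintype 𝒳] [Fintype 𝒮] [Fintype 𝒴] [Fintype 𝒴₁]

/-- `R` is achievable by deterministic codes over the compound primitive relay
channel with state set `Q`. -/
def CompAchievable (W : 𝒳 → 𝒮 → 𝒴 × 𝒴₁ → ℝ) (C1 : ℝ) (Q : Set (𝒮 → ℝ)) (R : ℝ) : Prop :=
  ∀ ε > (0 : ℝ), ∃ N : ℕ, ∀ n ≥ N, ∃ (M L : ℕ) (C : PCode 𝒳 𝒴 𝒴₁ n M L),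
    (2 : ℝ) ^ ((n : ℝ) * R) ≤ (M : ℝ) ∧ LinkOK n L C1 ∧
    ∀ q ∈ Q, C.errIID W q ≤ ε

/-- The deterministic code capacity of the compound primitive relay channel. -/
def CompCapacity (W : 𝒳 → 𝒮 → 𝒴 × 𝒴₁ → ℝ) (C1 : ℝ) (Q : Set (𝒮 → ℝ)) : ℝ :=
  sSup {R | CompAchievable W C1 Q R}

/-- `R` is achievable by random codes over the compound primitive relay channel. -/
def CompRandAchievable (W : 𝒳 → 𝒮 → 𝒴 × 𝒴₁ → ℝ) (C1 : ℝ) (Q : Set (𝒮 → ℝ)) (R : ℝ) :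
    Prop :=
  ∀ ε > (0 : ℝ), ∃ N : ℕ, ∀ n ≥ N, ∃ (M L : ℕ),
    (2 : ℝ) ^ ((n : ℝ) * R) ≤ (M : ℝ) ∧ LinkOK n L C1 ∧
    ∃ (J : Type) (π : PMF J) (Cs : J → PCode 𝒳 𝒴 𝒴₁ n M L),
      ∀ q ∈ Q, (∑' j, π j * ENNReal.ofReal ((Cs j).errIID W q)) ≤ ENNReal.ofReal ε

/-- The random code capacity of the compound primitive relay channel. -/
def CompRandCapacity (W : 𝒳 → 𝒮 → 𝒴 × 𝒴₁ → ℝ) (C1 : ℝ) (Q : Set (𝒮 → ℝ)) : ℝ :=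
  sSup {R | CompRandAchievable W C1 Q R}

/-- `R` is achievable by deterministic codes over the primitive AVRC: the average
error is small under every joint state distribution. -/
def AVRCAchievable (W : 𝒳 → 𝒮 → 𝒴 × 𝒴₁ → ℝ) (C1 R : ℝ) : Prop :=
  ∀ ε > (0 : ℝ), ∃ N : ℕ, ∀ n ≥ N, ∃ (M L : ℕ) (C : PCode 𝒳 𝒴 𝒴₁ n M L),
    (2 : ℝ) ^ ((n : ℝ) * R) ≤ (M : ℝ) ∧ LinkOK n L C1 ∧
    ∀ qn : (Fin n → 𝒮) → ℝ, IsPMF qn → C.errJoint W qn ≤ ε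

/-- The deterministic code capacity of the primitive AVRC. -/
def AVRCCapacity (W : 𝒳 → 𝒮 → 𝒴 × 𝒴₁ → ℝ) (C1 : ℝ) : ℝ :=
  sSup {R | AVRCAchievable W C1 R}

/-- `R` is achievable by random codes over the primitive AVRC. -/
def AVRCRandAchievable (W : 𝒳 → 𝒮 → 𝒴 × 𝒴₁ → ℝ) (C1 R : ℝ) : Prop :=
  ∀ ε > (0 : ℝ), ∃ N : ℕ, ∀ n ≥ N, ∃ (M L : ℕ),
    (2 : ℝ) ^ ((n : ℝ) * R) ≤ (M : ℝ) ∧ LinkOK n L C1 ∧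
    ∃ (J : Type) (π : PMF J) (Cs : J → PCode 𝒳 𝒴 𝒴₁ n M L),
      ∀ qn : (Fin n → 𝒮) → ℝ, IsPMF qn →
        (∑' j, π j * ENNReal.ofReal ((Cs j).errJoint W qn)) ≤ ENNReal.ofReal ε

/-- The random code capacity of the primitive AVRC. -/
def AVRCRandCapacity (W : 𝒳 → 𝒮 → 𝒴 × 𝒴₁ → ℝ) (C1 : ℝ) : ℝ :=
  sSup {R | AVRCRandAchievable W C1 R}

end Capacities

/-- The channel is reversely strongly degraded:
`W(y,y₁|x,s) = W_{Y|X,S}(y|x,s)·W_{Y₁|Y}(y₁|y)`. -/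
def RevStronglyDegraded {𝒳 𝒮 𝒴 𝒴₁ : Type} [Fintype 𝒴] [Fintype 𝒴₁]
    (W : 𝒳 → 𝒮 → 𝒴 × 𝒴₁ → ℝ) : Prop :=
  ∃ (WY : 𝒳 → 𝒮 → 𝒴 → ℝ) (V : 𝒴 → 𝒴₁ → ℝ),
    (∀ x s, IsPMF (WY x s)) ∧ (∀ y, IsPMF (V y)) ∧
    ∀ x s y y1, W x s (y, y1) = WY x s y * V y y1

/-- A state-dependent DMC `V(z|x,s)` is symmetrizable. -/
def Symmetrizable {𝒳 𝒮 𝒵 : Type} [Fintype 𝒮] (V : 𝒳 → 𝒮 → 𝒵 → ℝ) : Prop :=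
  ∃ J : 𝒳 → 𝒮 → ℝ, (∀ x, IsPMF (J x)) ∧
    ∀ x x' z, (∑ s, V x s z * J x' s) = ∑ s, V x' s z * J x s

/-! ### Entropy and mutual information -/

lemma ent_eq_sum_negMulLog {α : Type} [Fintype α] (p : α → ℝ) :
    ent p = (∑ a, Real.negMulLog (p a)) / Real.log 2 := by
  simp only [ent, Real.logb, Real.negMulLog, Finset.sum_div, ← Finset.sum_neg_distrib]
  exact Finset.sum_congr rfl fun a _ => by ring

@[fun_prop]
lemma continuous_ent {α : Type} [Fintype α] : Continuous (ent : (α → ℝ) → ℝ) := by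
  have h : (ent : (α → ℝ) → ℝ) = fun p => (∑ a, Real.negMulLog (p a)) / Real.log 2 :=
    funext ent_eq_sum_negMulLog
  rw [h]
  fun_prop

lemma ent_mul_kernel {α β : Type} [Fintype α] [Fintype β] (p : α → ℝ) {K : α → β → ℝ}
    (hK : ∀ a, ∑ b, K a b = 1) :
    ent (fun ab : α × β => p ab.1 * K ab.1 ab.2) = ent p + ∑ a, p a * ent (K a) := by
  have key : ∀ a b, p a * K a b * Real.logb 2 (p a * K a b)
      = K a b * (p a * Real.logb 2 (p a)) + p a * (K a b * Real.logb 2 (K a b)) := by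
    intro a b
    rcases eq_or_ne (p a) 0 with h | h
    · simp [h]
    rcases eq_or_ne (K a b) 0 with h' | h'
    · simp [h']
    rw [Real.logb_mul h h']
    ring
  simp only [ent, Fintype.sum_prod_type, key, Finset.sum_add_distrib, ← Finset.sum_mul, hK,
    one_mul, ← Finset.mul_sum, mul_neg, Finset.sum_neg_distrib, neg_add]

/-- Mutual information of an input `p` and a channel `K` as output entropy minus noise entropy. -/
lemma mutInfo_mul_kernel {α β : Type} [Fintype α] [Fintype β] (p : α → ℝ) {K : α → β → ℝ}
    (hK : ∀ a, ∑ b, K a b = 1) :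
    mutInfo (fun ab : α × β => p ab.1 * K ab.1 ab.2)
      = ent (fun b => ∑ a, p a * K a b) - ∑ a, p a * ent (K a) := by
  simp only [mutInfo, ent_mul_kernel p hK, ← Finset.mul_sum, hK, mul_one]
  ring

/-- Appending to the second variable a further output of a channel depending on it alone does not
change mutual information. -/
lemma mutInfo_append_kernel {α β γ : Type} [Fintype α] [Fintype β] [Fintype γ] (a : α × β → ℝ)
    {V : β → γ → ℝ} (hV : ∀ b, ∑ c, V b c = 1) :
    mutInfo (fun x : α × (β × γ) => a (x.1, x.2.1) * V x.2.1 x.2.2) = mutInfo a := by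
  have h1 : ent (fun x : α × (β × γ) => a (x.1, x.2.1) * V x.2.1 x.2.2)
      = ent a + ∑ x, a x * ent (V x.2) := by
    rw [← ent_mul_kernel a (K := fun x => V x.2) fun x => hV x.2]
    simp only [ent, Fintype.sum_prod_type]
  have h2 : ent (fun x : β × γ => ∑ i, a (i, x.1) * V x.1 x.2)
      = ent (fun b => ∑ i, a (i, b)) + ∑ b, (∑ i, a (i, b)) * ent (V b) := by
    rw [← ent_mul_kernel _ hV]
    simp only [Finset.sum_mul]
  simp only [mutInfo, h1, h2, Fintype.sum_prod_type, ← Finset.mul_sum, hV, mul_one, Finset.sum_mul]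
  rw [Finset.sum_comm (f := fun x y => a (x, y) * ent (V y))]
  ring

lemma log_two_mul_mutInfo {α β : Type} [Fintype α] [Fintype β] {a : α × β → ℝ}
    (ha : ∀ x, 0 ≤ a x) :
    Real.log 2 * mutInfo a = ∑ x, ∑ y, a (x, y) *
      Real.log (a (x, y) / ((∑ y', a (x, y')) * ∑ x', a (x', y))) := by
  have hl : Real.log 2 ≠ 0 := (Real.log_pos one_lt_two).ne'
  have key : ∀ x y, a (x, y) * Real.log (a (x, y) / ((∑ y', a (x, y')) * ∑ x', a (x', y)))
      = a (x, y) * Real.log (a (x, y)) - a (x, y) * Real.log (∑ y', a (x, y'))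
        - a (x, y) * Real.log (∑ x', a (x', y)) := by
    intro x y
    rcases (ha (x, y)).eq_or_lt with h | h
    · simp [← h]
    have h1 : 0 < ∑ y', a (x, y') := h.trans_le
      (Finset.single_le_sum (f := fun y' => a (x, y')) (fun i _ => ha _) (Finset.mem_univ y))
    have h2 : 0 < ∑ x', a (x', y) := h.trans_le
      (Finset.single_le_sum (f := fun x' => a (x', y)) (fun i _ => ha _) (Finset.mem_univ x))
    rw [Real.log_div h.ne' (by positivity), Real.log_mul h1.ne' h2.ne']
    ring
  simp only [key, Finset.sum_sub_distrib, mutInfo, ent_eq_sum_negMulLog]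
  rw [Finset.sum_comm (f := fun x y => a (x, y) * Real.log (∑ x', a (x', y)))]
  simp only [← Finset.sum_mul, Real.negMulLog, Fintype.sum_prod_type, neg_mul,
    Finset.sum_neg_distrib]
  field_simp
  ring

/-- A variational lower bound on mutual information. -/
lemma sum_mul_log_le_mutInfo {α β : Type} [Fintype α] [Fintype β] {a : α × β → ℝ}
    (ha : IsPMF a) {φ : α → β → ℝ} (hφ0 : ∀ x y, 0 ≤ φ x y)
    (hφ : ∀ y, ∑ x, (∑ y', a (x, y')) * φ x y ≤ 1) (hne : ∀ x y, a (x, y) ≠ 0 → φ x y ≠ 0) :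
    ∑ x, ∑ y, a (x, y) * Real.log (φ x y) ≤ Real.log 2 * mutInfo a := by
  rw [log_two_mul_mutInfo ha.1, ← sub_nonpos]
  simp only [← Finset.sum_sub_distrib]
  have key : ∀ x y, a (x, y) * Real.log (φ x y)
      - a (x, y) * Real.log (a (x, y) / ((∑ y', a (x, y')) * ∑ x', a (x', y)))
      ≤ ((∑ y', a (x, y')) * φ x y) * (∑ x', a (x', y)) - a (x, y) := by
    intro x y
    have h1' : ∀ y ∈ Finset.univ, 0 ≤ a (x, y) := fun i _ => ha.1 _
    have h2' : ∀ x ∈ Finset.univ, 0 ≤ a (x, y) := fun i _ => ha.1 _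
    rcases (ha.1 (x, y)).eq_or_lt with h | h
    · simp only [← h, zero_mul, sub_zero]
      exact mul_nonneg (mul_nonneg (Finset.sum_nonneg h1') (hφ0 x y)) (Finset.sum_nonneg h2')
    have h1 : 0 < ∑ y', a (x, y') := h.trans_le
      (Finset.single_le_sum (f := fun y' => a (x, y')) h1' (Finset.mem_univ y))
    have h2 : 0 < ∑ x', a (x', y) := h.trans_le
      (Finset.single_le_sum (f := fun x' => a (x', y)) h2' (Finset.mem_univ x))
    have h3 : 0 < φ x y := (hφ0 x y).lt_of_ne' (hne x y h.ne')
    rw [← mul_sub, ← Real.log_div h3.ne' (by positivity)]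
    calc _ ≤ a (x, y) * (φ x y / (a (x, y) / ((∑ y', a (x, y')) * ∑ x', a (x', y))) - 1) := by
          gcongr
          exact Real.log_le_sub_one_of_pos (by positivity)
      _ = _ := by field_simp
  calc _ ≤ ∑ x, ∑ y, (((∑ y', a (x, y')) * φ x y) * (∑ x', a (x', y)) - a (x, y)) := by
        exact Finset.sum_le_sum fun x _ => Finset.sum_le_sum fun y _ => key x y
    _ = ∑ y, (∑ x, (∑ y', a (x, y')) * φ x y) * (∑ x', a (x', y)) - ∑ y, ∑ x, a (x, y) := by
        rw [Finset.sum_comm]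
        simp only [Finset.sum_sub_distrib, ← Finset.sum_mul]
    _ ≤ ∑ y, 1 * (∑ x', a (x', y)) - ∑ y, ∑ x, a (x, y) := by
        gcongr with y _
        · exact Finset.sum_nonneg fun i _ => ha.1 _
        · exact hφ y
    _ = 0 := by simp

/-- The data processing inequality for mutual information. -/
lemma mutInfo_degraded_le {α β γ : Type} [Fintype α] [Fintype β] [Fintype γ] {a : α × β → ℝ}
    (ha : IsPMF a) {V : β → γ → ℝ} (hV : ∀ b, IsPMF (V b)) :
    mutInfo (fun x : α × γ => ∑ b, a (x.1, b) * V b x.2) ≤ mutInfo a := by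
  set c : α × γ → ℝ := fun x => ∑ b, a (x.1, b) * V b x.2 with hc
  have hc0 : ∀ x, 0 ≤ c x := fun x => Finset.sum_nonneg fun b _ => mul_nonneg (ha.1 _) ((hV b).1 _)
  have hs1 : ∀ x, 0 ≤ ∑ z, c (x, z) := fun x => Finset.sum_nonneg fun z _ => hc0 _
  have hs2 : ∀ z, 0 ≤ ∑ x, c (x, z) := fun z => Finset.sum_nonneg fun x _ => hc0 _
  have hcx : ∀ x, ∑ z, c (x, z) = ∑ b, a (x, b) := fun x => by
    simp only [hc]
    rw [Finset.sum_comm]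
    simp only [← Finset.mul_sum, (hV _).2, mul_one]
  have hd : IsPMF (fun x : α × (β × γ) => a (x.1, x.2.1) * V x.2.1 x.2.2) := by
    refine ⟨fun x => mul_nonneg (ha.1 _) ((hV _).1 _), ?_⟩
    simp only [Fintype.sum_prod_type, ← Finset.mul_sum, (hV _).2, mul_one]
    rw [← ha.2, Fintype.sum_prod_type]
  have hl : 0 < Real.log 2 := Real.log_pos one_lt_two
  rw [← mutInfo_append_kernel a fun b => (hV b).2]
  refine le_of_mul_le_mul_left ?_ hl
  refine le_trans (le_of_eq ?_) (sum_mul_log_le_mutInfo hd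
    (φ := fun x y => c (x, y.2) / ((∑ z, c (x, z)) * ∑ x', c (x', y.2))) ?_ ?_ ?_)
  · rw [log_two_mul_mutInfo hc0]
    refine Finset.sum_congr rfl fun x _ => ?_
    conv_rhs => rw [Fintype.sum_prod_type, Finset.sum_comm]
    exact Finset.sum_congr rfl fun z _ =>
      Finset.sum_mul Finset.univ (fun b => a (x, b) * V b z) _
  · intro x y
    exact div_nonneg (hc0 _) (mul_nonneg (hs1 x) (hs2 y.2))
  · rintro ⟨y, z⟩
    simp only [Fintype.sum_prod_type, ← Finset.mul_sum, (hV _).2, mul_one, ← hcx]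
    calc _ ≤ ∑ x, c (x, z) / ∑ x', c (x', z) := by
          gcongr with x _
          rcases eq_or_ne (∑ z, c (x, z)) 0 with h | h
          · rw [h, zero_mul]
            exact div_nonneg (hc0 _) (hs2 z)
          · rw [mul_div_assoc', mul_div_mul_left _ _ h]
      _ ≤ 1 := by
          rw [← Finset.sum_div]
          exact div_self_le_one _
  · rintro x ⟨y, z⟩ h
    have h0 : 0 < a (x, y) * V y z := (hd.1 (x, y, z)).lt_of_ne' h
    have h1 : 0 < c (x, z) := h0.trans_le (Finset.single_le_sum
      (f := fun b => a (x, b) * V b z) (fun b _ => hd.1 (x, b, z)) (Finset.mem_univ y))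
    have h2 : 0 < ∑ z, c (x, z) := h1.trans_le
      (Finset.single_le_sum (f := fun z => c (x, z)) (fun b _ => hc0 _) (Finset.mem_univ z))
    have h3 : 0 < ∑ x', c (x', z) := h1.trans_le
      (Finset.single_le_sum (f := fun x => c (x, z)) (fun b _ => hc0 _) (Finset.mem_univ x))
    positivity

/-! ### The channel averaged over the state -/

/-- The channel obtained by averaging over a state with pmf `q`. -/
def stateAvg {𝒳 𝒮 𝒵 : Type} [Fintype 𝒮] (V : 𝒳 → 𝒮 → 𝒵 → ℝ) (q : 𝒮 → ℝ) (x : 𝒳) (z : 𝒵) : ℝ :=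
  ∑ s, q s * V x s z

lemma IsChannel.stateAvg_isPMF {𝒳 𝒮 𝒵 : Type} [Fintype 𝒮] [Fintype 𝒵]
    {V : 𝒳 → 𝒮 → 𝒵 → ℝ} (hV : IsChannel V) {q : 𝒮 → ℝ} (hq : IsPMF q) (x : 𝒳) : IsPMF (stateAvg V q x) := by
  refine ⟨fun z => Finset.sum_nonneg fun s _ => mul_nonneg (hq.1 s) ((hV x s).1 z), ?_⟩
  simp only [stateAvg]
  rw [Finset.sum_comm]
  simp only [← Finset.mul_sum, (hV _ _).2, mul_one, hq.2]

lemma stateAvg_combo {𝒳 𝒮 𝒵 : Type} [Fintype 𝒮] (V : 𝒳 → 𝒮 → 𝒵 → ℝ)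
    (q q' : 𝒮 → ℝ) (a b : ℝ) (x : 𝒳) (z : 𝒵) :
    stateAvg V (a • q + b • q') x z = a * stateAvg V q x z + b * stateAvg V q' x z := by
  simp only [stateAvg, Finset.mul_sum, ← Finset.sum_add_distrib]
  exact Finset.sum_congr rfl fun s _ => by simp; ring

/-- The information density of the channel `K` with input `p`, exponentiated. -/
def infoRatio {𝒳 𝒵 : Type} [Fintype 𝒳] (p : 𝒳 → ℝ) (K : 𝒳 → 𝒵 → ℝ) (x : 𝒳)
    (z : 𝒵) : ℝ :=
  K x z / ∑ x', p x' * K x' z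

lemma sum_mul_infoRatio_le_one {𝒳 𝒵 : Type} [Fintype 𝒳] (p : 𝒳 → ℝ) (K : 𝒳 → 𝒵 → ℝ)
    (z : 𝒵) :
    ∑ x, p x * infoRatio p K x z ≤ 1 := by
  simp only [infoRatio, ← mul_div_assoc, ← Finset.sum_div]
  exact div_self_le_one _

section StateAvg

variable {𝒳 𝒮 𝒵 : Type} [Fintype 𝒳] [Fintype 𝒮] [Fintype 𝒵]

lemma isPMF_mul_kernel {p : 𝒳 → ℝ} (hp : IsPMF p) {K : 𝒳 → 𝒵 → ℝ} (hK : ∀ x, IsPMF (K x)) :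
    IsPMF (fun xz : 𝒳 × 𝒵 => p xz.1 * K xz.1 xz.2) := by
  refine ⟨fun xz => mul_nonneg (hp.1 _) ((hK _).1 _), ?_⟩
  simp only [Fintype.sum_prod_type, ← Finset.mul_sum, (hK _).2, mul_one, hp.2]

/-- Mutual information between input and output of the channel `V` averaged over the state. -/
def stateInfo (V : 𝒳 → 𝒮 → 𝒵 → ℝ) (q : 𝒮 → ℝ) (p : 𝒳 → ℝ) : ℝ :=
  mutInfo (fun xz : 𝒳 × 𝒵 => p xz.1 * stateAvg V q xz.1 xz.2)

lemma continuous_stateInfo (V : 𝒳 → 𝒮 → 𝒵 → ℝ) :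
    Continuous fun qp : (𝒮 → ℝ) × (𝒳 → ℝ) => stateInfo V qp.1 qp.2 := by
  simp only [stateInfo, mutInfo, stateAvg]
  fun_prop

lemma infoRatio_nonneg {p : 𝒳 → ℝ} (hp : IsPMF p) {K : 𝒳 → 𝒵 → ℝ} (hK : ∀ x, IsPMF (K x))
    (x : 𝒳) (z : 𝒵) : 0 ≤ infoRatio p K x z :=
  div_nonneg ((hK x).1 z) (Finset.sum_nonneg fun i _ => mul_nonneg (hp.1 i) ((hK i).1 z))

lemma mul_kernel_le_output {p : 𝒳 → ℝ} (hp : IsPMF p) {K : 𝒳 → 𝒵 → ℝ} (hK : ∀ x, IsPMF (K x))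
    (x : 𝒳) (z : 𝒵) : p x * K x z ≤ ∑ x', p x' * K x' z :=
  Finset.single_le_sum (f := fun x' => p x' * K x' z)
    (fun i _ => mul_nonneg (hp.1 i) ((hK i).1 z)) (Finset.mem_univ x)

lemma infoRatio_pos {p : 𝒳 → ℝ} (hp : IsPMF p) {K : 𝒳 → 𝒵 → ℝ} (hK : ∀ x, IsPMF (K x))
    {x : 𝒳} {z : 𝒵} (h : p x * K x z ≠ 0) : 0 < infoRatio p K x z := by
  have h0 : 0 < p x * K x z := (mul_nonneg (hp.1 x) ((hK x).1 z)).lt_of_ne' h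
  exact div_pos (((hK x).1 z).lt_of_ne' (right_ne_zero_of_mul h))
    (h0.trans_le (mul_kernel_le_output hp hK x z))

/-- Mutual information is at least the expected information density of any other channel. -/
lemma sum_mul_log_infoRatio_le {p : 𝒳 → ℝ} (hp : IsPMF p) {K K' : 𝒳 → 𝒵 → ℝ}
    (hK : ∀ x, IsPMF (K x)) (hK' : ∀ x, IsPMF (K' x))
    (hne : ∀ x z, p x * K x z ≠ 0 → K' x z ≠ 0) :
    ∑ x, ∑ z, p x * K x z * Real.log (infoRatio p K' x z)
      ≤ Real.log 2 * mutInfo (fun xz : 𝒳 × 𝒵 => p xz.1 * K xz.1 xz.2) := by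
  refine sum_mul_log_le_mutInfo (isPMF_mul_kernel hp hK) (infoRatio_nonneg hp hK') ?_ ?_
  · intro z
    simp only [← Finset.mul_sum, (hK _).2, mul_one]
    exact sum_mul_infoRatio_le_one p K' z
  · exact fun x z h => (infoRatio_pos hp hK' (mul_ne_zero (left_ne_zero_of_mul h) (hne x z h))).ne'

lemma log_two_mul_mutInfo_mul_kernel {p : 𝒳 → ℝ} (hp : IsPMF p) {K : 𝒳 → 𝒵 → ℝ}
    (hK : ∀ x, IsPMF (K x)) :
    Real.log 2 * mutInfo (fun xz : 𝒳 × 𝒵 => p xz.1 * K xz.1 xz.2)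
      = ∑ x, ∑ z, p x * K x z * Real.log (infoRatio p K x z) := by
  rw [log_two_mul_mutInfo (isPMF_mul_kernel hp hK).1]
  refine Finset.sum_congr rfl fun x _ => Finset.sum_congr rfl fun z _ => ?_
  simp only [← Finset.mul_sum, (hK _).2, mul_one, infoRatio]
  rcases eq_or_ne (p x) 0 with h | h
  · simp [h]
  · rw [mul_div_mul_left _ _ h]

lemma concaveOn_stateInfo {V : 𝒳 → 𝒮 → 𝒵 → ℝ} (hV : IsChannel V) {q : 𝒮 → ℝ} (hq : IsPMF q) :
    ConcaveOn ℝ (stdSimplex ℝ 𝒳) (stateInfo V q) := by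
  refine ⟨convex_stdSimplex ℝ 𝒳, fun p hp p' hp' a b ha hb hab => ?_⟩
  have hK := hV.stateAvg_isPMF hq
  have hl : 0 < Real.log 2 := Real.log_pos one_lt_two
  simp only [stateInfo, mutInfo_mul_kernel _ fun x => (hK x).2, ent_eq_sum_negMulLog, smul_eq_mul]
  have h1 : ∀ r ∈ stdSimplex ℝ 𝒳, ∀ z, (∑ x, r x * stateAvg V q x z) ∈ Set.Ici (0 : ℝ) :=
    fun r hr z => Finset.sum_nonneg fun x _ => mul_nonneg (hr.1 x) ((hK x).1 z)
  have h2 : ∑ z, (a * Real.negMulLog (∑ x, p x * stateAvg V q x z)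
      + b * Real.negMulLog (∑ x, p' x * stateAvg V q x z))
      ≤ ∑ z, Real.negMulLog (∑ x, (a • p + b • p') x * stateAvg V q x z) := by
    refine Finset.sum_le_sum fun z _ => ?_
    refine (Real.concaveOn_negMulLog.2 (h1 p hp z) (h1 p' hp' z) ha hb hab).trans_eq ?_
    congr 1
    simp only [smul_eq_mul, Finset.mul_sum, ← Finset.sum_add_distrib]
    exact Finset.sum_congr rfl fun x _ => by simp; ring
  have h3 : ∀ g : 𝒳 → ℝ, ∑ x, (a • p + b • p') x * g x
      = a * ∑ x, p x * g x + b * ∑ x, p' x * g x := by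
    intro g
    simp only [Finset.mul_sum, ← Finset.sum_add_distrib]
    exact Finset.sum_congr rfl fun x _ => by simp; ring
  have h4 := div_le_div_of_nonneg_right h2 hl.le
  rw [h3]
  rw [Finset.sum_add_distrib, add_div, ← Finset.mul_sum, ← Finset.mul_sum, mul_div_assoc,
    mul_div_assoc] at h4
  linarith

lemma convexOn_stateInfo {V : 𝒳 → 𝒮 → 𝒵 → ℝ} (hV : IsChannel V) {p : 𝒳 → ℝ} (hp : IsPMF p) :
    ConvexOn ℝ (stdSimplex ℝ 𝒮) (fun q => stateInfo V q p) := by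
  refine convexOn_iff_forall_pos.2 ⟨convex_stdSimplex ℝ 𝒮, fun q hq q' hq' a b ha hb hab => ?_⟩
  have hr : IsPMF (a • q + b • q') := convex_stdSimplex ℝ 𝒮 hq hq' ha.le hb.le hab
  have hKq := hV.stateAvg_isPMF hq
  have hKq' := hV.stateAvg_isPMF hq'
  have hK := hV.stateAvg_isPMF hr
  have hl : 0 < Real.log 2 := Real.log_pos one_lt_two
  refine le_of_mul_le_mul_left ?_ hl
  simp only [stateInfo, smul_eq_mul]
  have e1 := sum_mul_log_infoRatio_le hp hKq hK fun x z h => by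
    rw [stateAvg_combo]
    have h1 : 0 < stateAvg V q x z := ((hKq x).1 z).lt_of_ne' (right_ne_zero_of_mul h)
    have h2 := (hKq' x).1 z
    positivity
  have e2 := sum_mul_log_infoRatio_le hp hKq' hK fun x z h => by
    rw [stateAvg_combo]
    have h1 : 0 < stateAvg V q' x z := ((hKq' x).1 z).lt_of_ne' (right_ne_zero_of_mul h)
    have h2 := (hKq x).1 z
    positivity
  have e3 := log_two_mul_mutInfo_mul_kernel hp hK
  rw [e3]
  have e4 : ∑ x, ∑ z, p x * stateAvg V (a • q + b • q') x z
        * Real.log (infoRatio p (stateAvg V (a • q + b • q')) x z)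
      = a * (∑ x, ∑ z, p x * stateAvg V q x z
        * Real.log (infoRatio p (stateAvg V (a • q + b • q')) x z))
      + b * ∑ x, ∑ z, p x * stateAvg V q' x z
        * Real.log (infoRatio p (stateAvg V (a • q + b • q')) x z) := by
    simp only [Finset.mul_sum, ← Finset.sum_add_distrib]
    refine Finset.sum_congr rfl fun x _ => Finset.sum_congr rfl fun z _ => ?_
    rw [stateAvg_combo V q q' a b x z]
    ring
  rw [e4]
  nlinarith [mul_le_mul_of_nonneg_left e1 ha.le, mul_le_mul_of_nonneg_left e2 hb.le]

/-- The information functional has a saddle point over input pmfs and a compact convex set of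
state pmfs. -/
lemma exists_saddle_stateInfo [Nonempty 𝒳] {V : 𝒳 → 𝒮 → 𝒵 → ℝ} (hV : IsChannel V)
    {Q : Set (𝒮 → ℝ)} (hQ : ∀ q ∈ Q, IsPMF q) (hQne : Q.Nonempty) (hQcomp : IsCompact Q)
    (hQconv : Convex ℝ Q) :
    ∃ q₀ ∈ Q, ∃ p₀ : 𝒳 → ℝ, IsPMF p₀ ∧
      ∀ q ∈ Q, ∀ p : 𝒳 → ℝ, IsPMF p → stateInfo V q₀ p ≤ stateInfo V q p₀ := by
  classical
  have hc := continuous_stateInfo V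
  have hQsub : Q ⊆ stdSimplex ℝ 𝒮 := hQ
  obtain ⟨q₀, hq₀, p₀, hp₀, h⟩ := Sion.exists_isSaddlePointOn (X := Q) (Y := stdSimplex ℝ 𝒳)
    (f := stateInfo V) hQne hQconv hQcomp
    (fun p _ => ((hc.comp (Continuous.prodMk_left p)).lowerSemicontinuous).lowerSemicontinuousOn _)
    (fun p hp => ((convexOn_stateInfo hV hp).subset hQsub hQconv).quasiconvexOn)
    (convex_stdSimplex ℝ 𝒳)
    ⟨_, single_mem_stdSimplex ℝ (Classical.arbitrary 𝒳)⟩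
    (isCompact_stdSimplex ℝ 𝒳)
    (fun q _ => ((hc.comp (Continuous.prodMk_right q)).upperSemicontinuous).upperSemicontinuousOn _)
    (fun q hq => (concaveOn_stateInfo hV (hQ q hq)).quasiconcaveOn)
  exact ⟨q₀, hq₀, p₀, hp₀, fun q hq p hp => h q hq p hp⟩

end StateAvg

/-! ### The information quantities of a reversely strongly degraded channel -/

lemma bddBelow_of_continuous {E : Type*} [TopologicalSpace E] {Q : Set E} (hQcomp : IsCompact Q)
    {F : E → ℝ} (hF : Continuous F) : BddBelow {v | ∃ q ∈ Q, v = F q} := by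
  refine (hQcomp.bddBelow_image hF.continuousOn).mono ?_
  rintro _ ⟨q, hq, rfl⟩
  exact ⟨q, hq, rfl⟩

section Degraded

variable {𝒳 𝒮 𝒴 𝒴₁ : Type} [Fintype 𝒳] [Fintype 𝒮] [Fintype 𝒴] [Fintype 𝒴₁]
  {W : 𝒳 → 𝒮 → 𝒴 × 𝒴₁ → ℝ} {WY : 𝒳 → 𝒮 → 𝒴 → ℝ} {V : 𝒴 → 𝒴₁ → ℝ}

lemma IqXY_eq_stateInfo (hV : ∀ y, IsPMF (V y))
    (hW : ∀ x s y y1, W x s (y, y1) = WY x s y * V y y1) (p : 𝒳 → ℝ) (q : 𝒮 → ℝ) :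
    IqXY W p q = stateInfo WY q p := by
  simp only [IqXY, stateInfo, stateAvg, hW, ← Finset.mul_sum, (hV _).2, mul_one]

lemma IqXYY1_eq_stateInfo (hV : ∀ y, IsPMF (V y))
    (hW : ∀ x s y y1, W x s (y, y1) = WY x s y * V y y1) (p : 𝒳 → ℝ) (q : 𝒮 → ℝ) :
    IqXYY1 W p q = stateInfo WY q p := by
  rw [stateInfo, ← mutInfo_append_kernel _ fun y => (hV y).2, IqXYY1]
  congr 1
  funext xz
  obtain ⟨x, y, y1⟩ := xz
  simp only [hW, stateAvg, mul_assoc, Finset.sum_mul]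

lemma RCS_eq {C1 : ℝ} (hC1 : 0 ≤ C1) (hV : ∀ y, IsPMF (V y))
    (hW : ∀ x s y y1, W x s (y, y1) = WY x s y * V y y1) (Q : Set (𝒮 → ℝ)) :
    RCS W C1 Q
      = sInf {r | ∃ q ∈ Q, r = sSup {v | ∃ p : 𝒳 → ℝ, IsPMF p ∧ v = IqXY W p q}} := by
  simp only [RCS, IqXYY1_eq_stateInfo hV hW, IqXY_eq_stateInfo hV hW,
    min_eq_right (le_add_of_nonneg_right hC1)]

/-- The value at a saddle point is the compound capacity expression. -/
lemma sInf_sSup_eq_of_saddle {V' : 𝒳 → 𝒮 → 𝒴 → ℝ} {Q : Set (𝒮 → ℝ)} {q₀ : 𝒮 → ℝ} {p₀ : 𝒳 → ℝ}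
    (hq₀ : q₀ ∈ Q) (hp₀ : IsPMF p₀)
    (h : ∀ q ∈ Q, ∀ p : 𝒳 → ℝ, IsPMF p → stateInfo V' q₀ p ≤ stateInfo V' q p₀) :
    sInf {r | ∃ q ∈ Q, r = sSup {v | ∃ p : 𝒳 → ℝ, IsPMF p ∧ v = stateInfo V' q p}}
      = stateInfo V' q₀ p₀ := by
  have hbdd : ∀ q, BddAbove {v | ∃ p : 𝒳 → ℝ, IsPMF p ∧ v = stateInfo V' q p} := by
    intro q
    refine ((isCompact_stdSimplex ℝ 𝒳).bddAbove_image (f := stateInfo V' q)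
      ((continuous_stateInfo V').comp (Continuous.prodMk_right q)).continuousOn).mono ?_
    rintro _ ⟨p, hp, rfl⟩
    exact ⟨p, hp, rfl⟩
  have hle : ∀ r ∈ {r | ∃ q ∈ Q, r = sSup {v | ∃ p : 𝒳 → ℝ, IsPMF p ∧ v = stateInfo V' q p}},
      stateInfo V' q₀ p₀ ≤ r := by
    rintro _ ⟨q, hq, rfl⟩
    exact (h q hq p₀ hp₀).trans (le_csSup (hbdd q) ⟨p₀, hp₀, rfl⟩)
  refine le_antisymm ((csInf_le ⟨_, hle⟩ ⟨q₀, hq₀, rfl⟩).trans ?_) (le_csInf ⟨_, q₀, hq₀, rfl⟩ hle)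
  refine csSup_le ⟨_, p₀, hp₀, rfl⟩ ?_
  rintro _ ⟨p, hp, rfl⟩
  exact h q₀ hq₀ p hp

lemma IqUY_eq {k : ℕ} (hV : ∀ y, IsPMF (V y))
    (hW : ∀ x s y y1, W x s (y, y1) = WY x s y * V y y1) (p : Fin k × 𝒳 → ℝ) (q : 𝒮 → ℝ) :
    IqUY W p q = mutInfo (fun uy : Fin k × 𝒴 => ∑ x, p (uy.1, x) * stateAvg WY q x uy.2) := by
  simp only [IqUY, stateAvg, hW, ← Finset.mul_sum, (hV _).2, mul_one, mul_assoc]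

lemma IqUY1_eq {k : ℕ} (hW : ∀ x s y y1, W x s (y, y1) = WY x s y * V y y1)
    (p : Fin k × 𝒳 → ℝ) (q : 𝒮 → ℝ) :
    IqUY1 W p q = mutInfo (fun uz : Fin k × 𝒴₁ =>
      ∑ y, (∑ x, p (uz.1, x) * stateAvg WY q x y) * V y uz.2) := by
  rw [IqUY1]
  congr 1
  funext uz
  simp only [stateAvg, hW, Finset.sum_mul, Finset.mul_sum]
  refine (Finset.sum_congr rfl fun x _ => Finset.sum_comm).trans ?_
  rw [Finset.sum_comm]
  exact Finset.sum_congr rfl fun y _ => Finset.sum_congr rfl fun x _ =>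
    Finset.sum_congr rfl fun s _ => by ring

lemma isPMF_sum_mul_kernel {k : ℕ} {p : Fin k × 𝒳 → ℝ} (hp : IsPMF p) {K : 𝒳 → 𝒴 → ℝ}
    (hK : ∀ x, IsPMF (K x)) : IsPMF (fun uy : Fin k × 𝒴 => ∑ x, p (uy.1, x) * K x uy.2) := by
  refine ⟨fun uy => Finset.sum_nonneg fun x _ => mul_nonneg (hp.1 _) ((hK x).1 _), ?_⟩
  rw [← hp.2]
  simp only [Fintype.sum_prod_type]
  refine Finset.sum_congr rfl fun u _ => ?_
  rw [Finset.sum_comm]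
  simp only [← Finset.mul_sum, (hK _).2, mul_one]

lemma IqUY1_le_IqUY {k : ℕ} (hWY : IsChannel WY) (hV : ∀ y, IsPMF (V y))
    (hW : ∀ x s y y1, W x s (y, y1) = WY x s y * V y y1) {p : Fin k × 𝒳 → ℝ} (hp : IsPMF p)
    {q : 𝒮 → ℝ} (hq : IsPMF q) : IqUY1 W p q ≤ IqUY W p q := by
  rw [IqUY1_eq hW, IqUY_eq hV hW]
  exact mutInfo_degraded_le (isPMF_sum_mul_kernel hp (hWY.stateAvg_isPMF hq)) hV

/-- The chain rule `I(U;Y) + I(X;Y|U) = I(X;Y)` for the Markov chain `U - X - Y`. -/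
lemma IqUY_add_IqXYgivenU {k : ℕ} (hWY : IsChannel WY) (hV : ∀ y, IsPMF (V y))
    (hW : ∀ x s y y1, W x s (y, y1) = WY x s y * V y y1) (p : Fin k × 𝒳 → ℝ)
    {q : 𝒮 → ℝ} (hq : IsPMF q) :
    IqUY W p q + IqXYgivenU W p q = stateInfo WY q (fun x => ∑ u, p (u, x)) := by
  have hK := hWY.stateAvg_isPMF hq
  have h1 : IqXYgivenU W p q
      = condMutInfo (fun uxy : Fin k × 𝒳 × 𝒴 => p (uxy.1, uxy.2.1)
        * stateAvg WY q uxy.2.1 uxy.2.2) := by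
    simp only [IqXYgivenU, stateAvg, hW, ← Finset.mul_sum, (hV _).2, mul_one]
  have h2 : ent (fun uxy : Fin k × 𝒳 × 𝒴 => p (uxy.1, uxy.2.1) * stateAvg WY q uxy.2.1 uxy.2.2)
      = ent p + ∑ ux, p ux * ent (stateAvg WY q ux.2) := by
    rw [← ent_mul_kernel p (K := fun ux => stateAvg WY q ux.2) fun ux => (hK ux.2).2]
    simp only [ent, Fintype.sum_prod_type]
  rw [IqUY_eq hV hW, h1, stateInfo,
    mutInfo_mul_kernel (fun x => ∑ u, p (u, x)) fun x => (hK x).2, mutInfo, condMutInfo, h2]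
  simp only [← Finset.mul_sum, (hK _).2, mul_one, Fintype.sum_prod_type, Finset.sum_mul]
  rw [Finset.sum_comm (f := fun x u => p (u, x) * ent (stateAvg WY q x))]
  have h3 : ∀ u, ∑ y, ∑ x, p (u, x) * stateAvg WY q x y = ∑ x, p (u, x) := by
    intro u
    rw [Finset.sum_comm]
    simp only [← Finset.mul_sum, (hK _).2, mul_one]
  have h4 : ∀ y, ∑ u, ∑ x, p (u, x) * stateAvg WY q x y
      = ∑ x, ∑ u, p (u, x) * stateAvg WY q x y := fun y => Finset.sum_comm
  simp only [h3, h4]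
  ring

lemma mutInfo_fin_one {β : Type} [Fintype β] {a : Fin 1 × β → ℝ} (ha : ∑ x, a x = 1) :
    mutInfo a = 0 := by
  simp only [Fintype.sum_prod_type, Finset.univ_unique, Finset.sum_singleton,
    Fin.default_eq_zero] at ha
  simp [mutInfo, ent, Fintype.sum_prod_type, ha]

lemma RDF_eq {C1 : ℝ} (hC1 : 0 ≤ C1) (hWY : IsChannel WY) (hV : ∀ y, IsPMF (V y))
    (hW : ∀ x s y y1, W x s (y, y1) = WY x s y * V y y1) {Q : Set (𝒮 → ℝ)}
    (hQ : ∀ q ∈ Q, IsPMF q) (hQcomp : IsCompact Q) {q₀ : 𝒮 → ℝ} {p₀ : 𝒳 → ℝ} (hq₀ : q₀ ∈ Q)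
    (hp₀ : IsPMF p₀)
    (h : ∀ q ∈ Q, ∀ p : 𝒳 → ℝ, IsPMF p → stateInfo WY q₀ p ≤ stateInfo WY q p₀) :
    RDF W C1 Q = stateInfo WY q₀ p₀ := by
  have hub : ∀ r ∈ {r | ∃ (k : ℕ) (p : Fin k × 𝒳 → ℝ), IsPMF p ∧
      r = min
        (sInf {v | ∃ q ∈ Q, v = IqUY W p q} + sInf {v | ∃ q ∈ Q, v = IqXYgivenU W p q} + C1)
        (sInf {v | ∃ q ∈ Q, v = IqUY1 W p q} + sInf {v | ∃ q ∈ Q, v = IqXYgivenU W p q})},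
      r ≤ stateInfo WY q₀ p₀ := by
    rintro _ ⟨k, p, hp, rfl⟩
    have hc1 : Continuous fun q => IqUY1 W p q := by
      simp only [IqUY1, mutInfo]
      fun_prop
    have hc2 : Continuous fun q => IqXYgivenU W p q := by
      simp only [IqXYgivenU, condMutInfo]
      fun_prop
    have hpX : IsPMF (fun x => ∑ u, p (u, x)) := by
      refine ⟨fun x => Finset.sum_nonneg fun u _ => hp.1 _, ?_⟩
      rw [Finset.sum_comm, ← Fintype.sum_prod_type, hp.2]
    calc _ ≤ IqUY1 W p q₀ + IqXYgivenU W p q₀ :=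
          (min_le_right _ _).trans (add_le_add
            (csInf_le (bddBelow_of_continuous hQcomp hc1) ⟨q₀, hq₀, rfl⟩)
            (csInf_le (bddBelow_of_continuous hQcomp hc2) ⟨q₀, hq₀, rfl⟩))
      _ ≤ IqUY W p q₀ + IqXYgivenU W p q₀ := by
          gcongr
          exact IqUY1_le_IqUY hWY hV hW hp (hQ q₀ hq₀)
      _ ≤ _ := by
          rw [IqUY_add_IqXYgivenU hWY hV hW p (hQ q₀ hq₀)]
          exact h q₀ hq₀ _ hpX
  set p : Fin 1 × 𝒳 → ℝ := fun ux => p₀ ux.2 with hpdef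
  have hp : IsPMF p := ⟨fun ux => hp₀.1 _, by simp [hpdef, Fintype.sum_prod_type, hp₀.2]⟩
  have hU : ∀ q ∈ Q, IqUY W p q = 0 := by
    intro q hq
    rw [IqUY_eq hV hW]
    exact mutInfo_fin_one (isPMF_sum_mul_kernel hp (hWY.stateAvg_isPMF (hQ q hq))).2
  have hU1 : ∀ q ∈ Q, IqUY1 W p q = 0 := by
    intro q hq
    rw [IqUY1_eq hW]
    refine mutInfo_fin_one ?_
    have h1 := (isPMF_sum_mul_kernel hp (hWY.stateAvg_isPMF (hQ q hq))).2
    rw [← h1]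
    simp only [Fintype.sum_prod_type]
    refine Finset.sum_congr rfl fun u _ => ?_
    rw [Finset.sum_comm]
    simp only [← Finset.mul_sum, (hV _).2, mul_one]
  have hX : ∀ q ∈ Q, IqXYgivenU W p q = stateInfo WY q p₀ := by
    intro q hq
    have h1 := IqUY_add_IqXYgivenU hWY hV hW p (hQ q hq)
    rw [hU q hq, zero_add] at h1
    simpa [hpdef] using h1
  refine le_antisymm (csSup_le ⟨_, 1, p, hp, rfl⟩ hub) (le_csSup_of_le ⟨_, hub⟩ ⟨1, p, hp, rfl⟩ ?_)
  have hb : stateInfo WY q₀ p₀ ≤ sInf {v | ∃ q ∈ Q, v = IqXYgivenU W p q} := by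
    refine le_csInf ⟨_, q₀, hq₀, rfl⟩ ?_
    rintro _ ⟨q, hq, rfl⟩
    rw [hX q hq]
    exact h q hq p₀ hp₀
  have hb1 : 0 ≤ sInf {v | ∃ q ∈ Q, v = IqUY W p q} := by
    refine Real.sInf_nonneg ?_
    rintro _ ⟨q, hq, rfl⟩
    exact (hU q hq).ge
  have hb2 : 0 ≤ sInf {v | ∃ q ∈ Q, v = IqUY1 W p q} := by
    refine Real.sInf_nonneg ?_
    rintro _ ⟨q, hq, rfl⟩
    exact (hU1 q hq).ge
  exact le_min (by linarith) (by linarith)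

end Degraded

/-! ### Block codes -/

lemma sum_prod_apply_mul {ι Z : Type} [Fintype ι] [DecidableEq ι] [Fintype Z] {f : ι → Z → ℝ}
    (hf : ∀ i, ∑ z, f i z = 1) (F : Z → ℝ) (i : ι) :
    ∑ z : ι → Z, (∏ j, f j (z j)) * F (z i) = ∑ w, f i w * F w := by
  have h : ∀ z : ι → Z, (∏ j, f j (z j)) * F (z i)
      = ∏ j, f j (z j) * (if j = i then F (z j) else 1) := by
    intro z
    rw [Finset.prod_mul_distrib, Finset.prod_ite_eq' Finset.univ i]
    simp
  simp only [h]
  rw [← Fintype.prod_sum fun j w => f j w * (if j = i then F w else 1),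
    Finset.prod_eq_single i (fun j _ hj => by simp [hj, hf]) (by simp)]
  simp

lemma sum_prod_apply_eq_one {ι Z : Type} [Fintype ι] [DecidableEq ι] [Fintype Z] {f : ι → Z → ℝ}
    (hf : ∀ i, ∑ z, f i z = 1) : ∑ z : ι → Z, ∏ j, f j (z j) = 1 := by
  rw [← Fintype.prod_sum]
  simp [hf]

/-- The error probability of the relay code is that of an ordinary code on the state-averaged
channel. -/
lemma PCode.errIID_eq {𝒳 𝒮 𝒴 𝒴₁ : Type} [Fintype 𝒮] [Fintype 𝒴] [Fintype 𝒴₁] {n M L : ℕ}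
    (C : PCode 𝒳 𝒴 𝒴₁ n M L) (W : 𝒳 → 𝒮 → 𝒴 × 𝒴₁ → ℝ) (q : 𝒮 → ℝ) :
    C.errIID W q = (M : ℝ)⁻¹ * ∑ m, ∑ z : Fin n → 𝒴 × 𝒴₁,
      if C.g (fun i => (z i).1, C.f1 fun i => (z i).2) = m then 0
      else ∏ i, stateAvg W q (C.f m i) (z i) := by
  have h1 : ∀ s, C.errGiven W s = (M : ℝ)⁻¹ * ∑ m, ∑ z : Fin n → 𝒴 × 𝒴₁,
      if C.g (fun i => (z i).1, C.f1 fun i => (z i).2) = m then 0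
      else ∏ i, W (C.f m i) (s i) (z i) := by
    intro s
    rw [PCode.errGiven]
    congr 1
    refine Finset.sum_congr rfl fun m _ => ?_
    rw [← Fintype.sum_prod_type', ← (Equiv.arrowProdEquivProdArrow (Fin n) (fun _ => 𝒴)
      (fun _ => 𝒴₁)).sum_comp]
    rfl
  have h2 : ∀ m (z : Fin n → 𝒴 × 𝒴₁), ∏ i, stateAvg W q (C.f m i) (z i)
      = ∑ s : Fin n → 𝒮, (∏ i, q (s i)) * ∏ i, W (C.f m i) (s i) (z i) := by
    intro m z
    simp only [stateAvg]
    rw [Fintype.prod_sum]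
    simp only [Finset.prod_mul_distrib]
  simp only [PCode.errIID, h1, h2, Finset.mul_sum]
  rw [Finset.sum_comm]
  refine Finset.sum_congr rfl fun m _ => ?_
  rw [Finset.sum_comm]
  refine Finset.sum_congr rfl fun z _ => ?_
  split_ifs
  · simp
  · rw [Finset.mul_sum]
    exact Finset.sum_congr rfl fun s _ => by ring

/-! ### The converse -/

/-- Averaging over the codewords of a code is averaging over the empirical input distribution. -/
lemma sum_div_card_eq_sum_empirical {𝒳 : Type} [Fintype 𝒳] [DecidableEq 𝒳] {M : ℕ}
    (c : Fin M → 𝒳) (F : 𝒳 → ℝ) :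
    ∑ x, (∑ m, if c m = x then (M : ℝ)⁻¹ else 0) * F x = ∑ m, (M : ℝ)⁻¹ * F (c m) := by
  simp only [Finset.sum_mul]
  rw [Finset.sum_comm]
  exact Finset.sum_congr rfl fun m _ => by simp

/-- A weak converse for block codes on a memoryless channel. -/
lemma log_card_le_of_error_le {𝒳 𝒵 : Type} [Fintype 𝒳] [Fintype 𝒵] {K : 𝒳 → 𝒵 → ℝ}
    (hK : ∀ x, IsPMF (K x)) {B : ℝ}
    (hB : ∀ p : 𝒳 → ℝ, IsPMF p →
      Real.log 2 * mutInfo (fun xz : 𝒳 × 𝒵 => p xz.1 * K xz.1 xz.2) ≤ B)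
    {n M : ℕ} (hM : 0 < M) (c : Fin M → Fin n → 𝒳) (g : (Fin n → 𝒵) → Fin M) {ε : ℝ}
    (hε : (M : ℝ)⁻¹ * ∑ m, ∑ z : Fin n → 𝒵, (if g z = m then 0 else ∏ i, K (c m i) (z i)) ≤ ε) :
    (1 - ε) * Real.log M ≤ n * B + 1 := by
  classical
  have hM0 : (0 : ℝ) < M := Nat.cast_pos.2 hM
  have hM1 : (1 : ℝ) ≤ M := Nat.one_le_cast.2 hM
  have hMi : ∑ _m : Fin M, (M : ℝ)⁻¹ = 1 := by simp [hM0.ne']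
  set P : Fin M → (Fin n → 𝒵) → ℝ := fun m z => (M : ℝ)⁻¹ * ∏ i, K (c m i) (z i) with hP
  set r : Fin n → 𝒵 → ℝ := fun i w => ∑ m, (M : ℝ)⁻¹ * K (c m i) w with hr
  set h : Fin M → (Fin n → 𝒵) → ℝ := fun m z => if g z = m then (M : ℝ) else 1 with hh
  have hr0 : ∀ i w, 0 ≤ r i w := fun i w =>
    Finset.sum_nonneg fun m _ => mul_nonneg (inv_nonneg.2 hM0.le) ((hK _).1 w)
  have hr1 : ∀ i, ∑ w, r i w = 1 := fun i => by
    simp only [hr]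
    rw [Finset.sum_comm]
    simp only [← Finset.mul_sum, (hK _).2, mul_one, hMi]
  have hh0 : ∀ m z, 0 < h m z := fun m z => by simp only [hh]; split_ifs <;> positivity
  have hP0 : ∀ m z, 0 ≤ P m z := fun m z =>
    mul_nonneg (inv_nonneg.2 hM0.le) (Finset.prod_nonneg fun i _ => (hK _).1 _)
  have hP1 : ∀ m, ∑ z, P m z = (M : ℝ)⁻¹ := fun m => by
    simp only [hP, ← Finset.mul_sum]
    rw [sum_prod_apply_eq_one fun i => (hK (c m i)).2, mul_one]
  have key : ∀ m z, P m z * Real.log (h m z)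
      ≤ ∑ i, P m z * Real.log (K (c m i) (z i) / r i (z i))
        + ((M : ℝ)⁻¹ * (∏ i, r i (z i)) * h m z - P m z) := by
    intro m z
    have hR : 0 ≤ ∏ i, r i (z i) := Finset.prod_nonneg fun i _ => hr0 i _
    rcases (hP0 m z).eq_or_lt with h0 | h0
    · simp only [← h0, zero_mul, Finset.sum_const_zero, zero_add, sub_zero]
      have := hh0 m z
      positivity
    have hKpos : ∀ i, 0 < K (c m i) (z i) := fun i => ((hK _).1 _).lt_of_ne' fun h1 =>
      h0.ne' (by simp only [hP]; rw [Finset.prod_eq_zero (Finset.mem_univ i) h1, mul_zero])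
    have hrpos : ∀ i, 0 < r i (z i) := fun i =>
      (mul_pos (inv_pos.2 hM0) (hKpos i)).trans_le
        (Finset.single_le_sum (f := fun m => (M : ℝ)⁻¹ * K (c m i) (z i))
          (fun m _ => mul_nonneg (inv_nonneg.2 hM0.le) ((hK _).1 _)) (Finset.mem_univ m))
    have hRpos : 0 < ∏ i, r i (z i) := Finset.prod_pos fun i _ => hrpos i
    have hKp : 0 < ∏ i, K (c m i) (z i) := Finset.prod_pos fun i _ => hKpos i
    rw [← Finset.mul_sum, ← Real.log_prod fun i _ => (div_pos (hKpos i) (hrpos i)).ne',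
      Finset.prod_div_distrib, ← sub_le_iff_le_add', ← mul_sub,
      ← Real.log_div (hh0 m z).ne' (div_pos hKp hRpos).ne']
    calc _ ≤ P m z * (h m z / ((∏ i, K (c m i) (z i)) / ∏ i, r i (z i)) - 1) := by
          gcongr
          exact Real.log_le_sub_one_of_pos (div_pos (hh0 m z) (div_pos hKp hRpos))
      _ = _ := by
          simp only [hP]
          field_simp
  have hsum := Finset.sum_le_sum fun m (_ : m ∈ Finset.univ) =>
    Finset.sum_le_sum fun z (_ : z ∈ Finset.univ) => key m z
  simp only [Finset.sum_add_distrib, Finset.sum_sub_distrib, hP1, hMi] at hsum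
  have hlhs : ∑ m, ∑ z, P m z * Real.log (h m z)
      = (1 - (M : ℝ)⁻¹ * ∑ m, ∑ z : Fin n → 𝒵,
        (if g z = m then 0 else ∏ i, K (c m i) (z i))) * Real.log M := by
    have h1 : ∀ m z, P m z * Real.log (h m z)
        = (P m z - (M : ℝ)⁻¹ * (if g z = m then 0 else ∏ i, K (c m i) (z i))) * Real.log M := by
      intro m z
      simp only [hh, hP]
      split_ifs <;> simp
    simp only [h1, ← Finset.sum_mul, Finset.sum_sub_distrib, hP1, hMi, ← Finset.mul_sum]
  have hinfo : ∑ m, ∑ z, ∑ i, P m z * Real.log (K (c m i) (z i) / r i (z i)) ≤ n * B := by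
    have h1 : ∑ m, ∑ z, ∑ i, P m z * Real.log (K (c m i) (z i) / r i (z i))
        = ∑ i, ∑ m, (M : ℝ)⁻¹ * ∑ w, K (c m i) w * Real.log (K (c m i) w / r i w) := by
      rw [Finset.sum_comm (s := Finset.univ (α := Fin n))]
      refine Finset.sum_congr rfl fun m _ => ?_
      rw [Finset.sum_comm]
      refine Finset.sum_congr rfl fun i _ => ?_
      rw [← sum_prod_apply_mul (f := fun i => K (c m i)) (fun i => (hK _).2)
        (fun w => Real.log (K (c m i) w / r i w)) i, Finset.mul_sum]
      exact Finset.sum_congr rfl fun z _ => mul_assoc _ _ _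
    have h2 : ∀ i, ∑ m, (M : ℝ)⁻¹ * ∑ w, K (c m i) w * Real.log (K (c m i) w / r i w) ≤ B := by
      intro i
      set p : 𝒳 → ℝ := fun x => ∑ m, if c m i = x then (M : ℝ)⁻¹ else 0 with hp
      have hpp : IsPMF p := by
        refine ⟨fun x => Finset.sum_nonneg fun m _ => by split_ifs <;> positivity, ?_⟩
        have := sum_div_card_eq_sum_empirical (fun m => c m i) fun _ => 1
        simpa only [mul_one, hMi] using this
      have hrp : ∀ w, r i w = ∑ x, p x * K x w := fun w =>
        (sum_div_card_eq_sum_empirical (fun m => c m i) fun x => K x w).symm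
      refine le_trans (le_of_eq ?_) (hB p hpp)
      rw [log_two_mul_mutInfo_mul_kernel hpp hK, ← sum_div_card_eq_sum_empirical (fun m => c m i)
        fun x => ∑ w, K x w * Real.log (K x w / r i w)]
      refine Finset.sum_congr rfl fun x _ => ?_
      rw [Finset.mul_sum]
      refine Finset.sum_congr rfl fun w _ => ?_
      rw [infoRatio, hrp, mul_assoc]
    rw [h1]
    calc _ ≤ ∑ _i : Fin n, B := Finset.sum_le_sum fun i _ => h2 i
      _ = n * B := by simp
  have hout : ∑ m, ∑ z, (M : ℝ)⁻¹ * (∏ i, r i (z i)) * h m z ≤ 2 := by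
    rw [Finset.sum_comm]
    have h1 : ∀ z, ∑ m, (M : ℝ)⁻¹ * (∏ i, r i (z i)) * h m z ≤ 2 * ∏ i, r i (z i) := by
      intro z
      have hR : 0 ≤ ∏ i, r i (z i) := Finset.prod_nonneg fun i _ => hr0 i _
      have h2 : ∑ m, h m z ≤ 2 * M := by
        calc ∑ m, h m z ≤ ∑ m, ((if g z = m then (M : ℝ) else 0) + 1) :=
              Finset.sum_le_sum fun m _ => by simp only [hh]; split_ifs <;> simp
          _ = 2 * M := by simp [Finset.sum_add_distrib]; ring
      rw [← Finset.mul_sum]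
      calc _ ≤ (M : ℝ)⁻¹ * (∏ i, r i (z i)) * (2 * M) := by gcongr
        _ = _ := by field_simp
    refine (Finset.sum_le_sum fun z _ => h1 z).trans_eq ?_
    rw [← Finset.mul_sum, sum_prod_apply_eq_one hr1, mul_one]
  rw [hlhs] at hsum
  have hlog : 0 ≤ Real.log M := Real.log_nonneg hM1
  have := mul_le_mul_of_nonneg_right (sub_le_sub_left hε 1) hlog
  linarith

/-- Achievable rates are at most the information of the two outputs, maximised over inputs. -/
lemma CompAchievable.le {𝒳 𝒮 𝒴 𝒴₁ : Type} [Fintype 𝒳] [Fintype 𝒮] [Fintype 𝒴] [Fintype 𝒴₁]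
    {W : 𝒳 → 𝒮 → 𝒴 × 𝒴₁ → ℝ} (hW : IsChannel W) {C1 : ℝ} {Q : Set (𝒮 → ℝ)} {q : 𝒮 → ℝ}
    (hqQ : q ∈ Q) (hq : IsPMF q) {T : ℝ} (hT : ∀ p : 𝒳 → ℝ, IsPMF p → stateInfo W q p ≤ T)
    {R : ℝ} (hR : CompAchievable W C1 Q R) : R ≤ T := by
  have hl : 0 < Real.log 2 := Real.log_pos one_lt_two
  by_contra! hlt
  set ε := min (1 / 2) ((R - T) / (2 * (|R| + 1))) with hε
  have habs := abs_nonneg R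
  have hε0 : 0 < ε := lt_min (by norm_num) (div_pos (by linarith) (by linarith))
  have hε1 : ε ≤ 1 / 2 := min_le_left _ _
  have hεR : ε * R ≤ (R - T) / 2 := by
    calc ε * R ≤ ε * (|R| + 1) := by
          gcongr
          linarith [le_abs_self R]
      _ ≤ (R - T) / (2 * (|R| + 1)) * (|R| + 1) := by
          gcongr
          exact min_le_right _ _
      _ = _ := by field_simp
  obtain ⟨N, hN⟩ := hR ε hε0
  obtain ⟨k, hk⟩ := exists_nat_gt (1 / (Real.log 2 * ((R - T) / 2)))
  have hd : 0 < Real.log 2 * ((R - T) / 2) := mul_pos hl (by linarith)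
  obtain ⟨n, hNn, hkn⟩ : ∃ n, N ≤ n ∧ k ≤ n := ⟨max N k, le_max_left _ _, le_max_right _ _⟩
  obtain ⟨M, L, C, hM, -, hC⟩ := hN n hNn
  have hn : 1 < n * (Real.log 2 * ((R - T) / 2)) := by
    rw [div_lt_iff₀ hd] at hk
    refine hk.trans_le ?_
    gcongr
  have hM0 : (0 : ℝ) < M := (Real.rpow_pos_of_pos two_pos _).trans_le hM
  have herr := hC q hqQ
  rw [C.errIID_eq] at herr
  have h1 := log_card_le_of_error_le (hW.stateAvg_isPMF hq) (B := Real.log 2 * T)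
    (fun p hp => mul_le_mul_of_nonneg_left (hT p hp) hl.le) (Nat.cast_pos.1 hM0) C.f
    (fun z => C.g (fun i => (z i).1, C.f1 fun i => (z i).2)) herr
  have h2 : n * R * Real.log 2 ≤ Real.log M := by
    rw [← Real.log_rpow two_pos]
    exact Real.log_le_log (Real.rpow_pos_of_pos two_pos _) hM
  have h3 := mul_le_mul_of_nonneg_left h2 (by linarith : 0 ≤ 1 - ε)
  have h4 : (n * Real.log 2) * (ε * R) ≤ (n * Real.log 2) * ((R - T) / 2) := by gcongr
  nlinarith

/-! ### A decoding metric for a convex family of channels -/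

lemma Convex.exists_forall_pos {𝒮 : Type} [Fintype 𝒮] {Q : Set (𝒮 → ℝ)} (hQconv : Convex ℝ Q)
    (hQne : Q.Nonempty) (hQ : ∀ q ∈ Q, ∀ s, 0 ≤ q s) :
    ∃ q₀ ∈ Q, ∀ q ∈ Q, ∀ s, 0 < q s → 0 < q₀ s := by
  classical
  have h : ∀ t : Finset 𝒮, ∃ q₀ ∈ Q, ∀ q ∈ Q, ∀ s ∈ t, 0 < q s → 0 < q₀ s := by
    intro t
    induction t using Finset.induction_on with
    | empty => exact ⟨hQne.some, hQne.some_mem, by simp⟩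
    | insert a t _ ih =>
      obtain ⟨q₀, hq₀, h₀⟩ := ih
      by_cases ha : ∃ q ∈ Q, 0 < q a
      · obtain ⟨q₁, hq₁, h₁⟩ := ha
        refine ⟨(1 / 2 : ℝ) • q₀ + (1 / 2 : ℝ) • q₁,
          hQconv hq₀ hq₁ (by norm_num) (by norm_num) (by norm_num), fun q hq s hs hpos => ?_⟩
        have e0 := hQ q₀ hq₀ s
        have e1 := hQ q₁ hq₁ s
        simp only [Pi.add_apply, Pi.smul_apply, smul_eq_mul]
        rcases Finset.mem_insert.1 hs with rfl | hs
        · linarith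
        · linarith [h₀ q hq s hs hpos]
      · refine ⟨q₀, hq₀, fun q hq s hs hpos => ?_⟩
        rcases Finset.mem_insert.1 hs with rfl | hs
        · exact absurd ⟨q, hq, hpos⟩ ha
        · exact h₀ q hq s hs hpos
  obtain ⟨q₀, hq₀, h₀⟩ := h Finset.univ
  exact ⟨q₀, hq₀, fun q hq s => h₀ q hq s (Finset.mem_univ s)⟩

section Metric

variable {𝒳 𝒮 𝒵 : Type} [Fintype 𝒳] [Fintype 𝒮] [Fintype 𝒵]

/-- If the information at `q` does not increase when moving towards `q'`, then the information
density at `q` has expectation under `q'` at least the information at `q`. -/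
lemma le_sum_mul_log_infoRatio {V : 𝒳 → 𝒮 → 𝒵 → ℝ} (hV : IsChannel V) {p : 𝒳 → ℝ} (hp : IsPMF p)
    {q q' : 𝒮 → ℝ} (hq : IsPMF q) (hq' : IsPMF q')
    (hpos : ∀ x z, p x * stateAvg V q' x z ≠ 0 → stateAvg V q x z ≠ 0)
    (hmin : ∀ t ∈ Set.Ioo (0 : ℝ) 1, stateInfo V q p ≤ stateInfo V ((1 - t) • q + t • q') p) :
    Real.log 2 * stateInfo V q p
      ≤ ∑ x, ∑ z, p x * stateAvg V q' x z * Real.log (infoRatio p (stateAvg V q) x z) := by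
  have hl : 0 < Real.log 2 := Real.log_pos one_lt_two
  have hK := hV.stateAvg_isPMF hq
  have hK' := hV.stateAvg_isPMF hq'
  set F : ℝ → ℝ := fun t => ∑ x, ∑ z, p x * stateAvg V q' x z
    * Real.log (infoRatio p (stateAvg V ((1 - t) • q + t • q')) x z) with hF
  have hF0 : Filter.Tendsto F (nhdsWithin 0 (Set.Ioi 0)) (nhds (∑ x, ∑ z, p x * stateAvg V q' x z
      * Real.log (infoRatio p (stateAvg V q) x z))) := by
    refine tendsto_finsetSum _ fun x _ => tendsto_finsetSum _ fun z _ => ?_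
    rcases eq_or_ne (p x * stateAvg V q' x z) 0 with h | h
    · simp [h]
    refine Filter.Tendsto.const_mul _ ?_
    have hx : p x * stateAvg V q x z ≠ 0 := mul_ne_zero (left_ne_zero_of_mul h) (hpos x z h)
    have hr : ∑ x', p x' * stateAvg V q x' z ≠ 0 :=
      (((mul_nonneg (hp.1 x) ((hK x).1 z)).lt_of_ne' hx).trans_le
        (mul_kernel_le_output hp hK x z)).ne'
    have hc : ContinuousAt (fun t : ℝ =>
        Real.log (infoRatio p (stateAvg V ((1 - t) • q + t • q')) x z)) 0 := by
      simp only [infoRatio, stateAvg_combo]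
      refine ContinuousAt.log (ContinuousAt.div (by fun_prop) (by fun_prop) ?_) ?_
      · simpa using hr
      · simpa using ⟨hpos x z h, hr⟩
    have := hc.tendsto.mono_left (nhdsWithin_le_nhds (s := Set.Ioi 0))
    simpa using this
  refine ge_of_tendsto hF0 ?_
  filter_upwards [Ioo_mem_nhdsGT (zero_lt_one' ℝ)] with t ht
  have ht0 := ht.1
  have ht1 : 0 < 1 - t := sub_pos.2 ht.2
  have hqt : IsPMF ((1 - t) • q + t • q') :=
    convex_stdSimplex ℝ 𝒮 hq hq' ht1.le ht0.le (by ring)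
  have hKt := hV.stateAvg_isPMF hqt
  have e1 := sum_mul_log_infoRatio_le hp hK hKt fun x z h => by
    rw [stateAvg_combo]
    have h1 : 0 < stateAvg V q x z := ((hK x).1 z).lt_of_ne' (right_ne_zero_of_mul h)
    have h2 := (hK' x).1 z
    positivity
  have e2 := mul_le_mul_of_nonneg_left (hmin t ht) hl.le
  have e3 : Real.log 2 * stateInfo V ((1 - t) • q + t • q') p
      = (1 - t) * (∑ x, ∑ z, p x * stateAvg V q x z
        * Real.log (infoRatio p (stateAvg V ((1 - t) • q + t • q')) x z)) + t * F t := by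
    rw [stateInfo, log_two_mul_mutInfo_mul_kernel hp hKt]
    simp only [hF, Finset.mul_sum, ← Finset.sum_add_distrib]
    refine Finset.sum_congr rfl fun x _ => Finset.sum_congr rfl fun z _ => ?_
    rw [stateAvg_combo V q q' (1 - t) t x z]
    ring
  have e4 := mul_le_mul_of_nonneg_left e1 ht1.le
  rw [e3] at e2
  have e5 : t * (Real.log 2 * stateInfo V q p) ≤ t * F t := by
    simp only [stateInfo] at e2 e4 ⊢
    linarith
  exact le_of_mul_le_mul_left e5 ht0

/-- A compact convex family of channels has a single decoding metric whose expectation under each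
of its members is almost the least mutual information of the family. -/
lemma exists_metric {V : 𝒳 → 𝒮 → 𝒵 → ℝ} (hV : IsChannel V) {p : 𝒳 → ℝ} (hp : IsPMF p)
    {Q : Set (𝒮 → ℝ)} (hQ : ∀ q ∈ Q, IsPMF q) (hQne : Q.Nonempty) (hQcomp : IsCompact Q)
    (hQconv : Convex ℝ Q) {I δ : ℝ} (hI : ∀ q ∈ Q, I ≤ Real.log 2 * stateInfo V q p)
    (hδ : 0 < δ) :
    ∃ φ : 𝒳 → 𝒵 → ℝ, (∀ x z, 0 ≤ φ x z) ∧ (∀ z, ∑ x, p x * φ x z ≤ 1) ∧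
      (∀ q ∈ Q, ∀ x z, p x * stateAvg V q x z ≠ 0 → 0 < φ x z) ∧
      ∀ q ∈ Q, I - δ ≤ ∑ x, ∑ z, p x * stateAvg V q x z * Real.log (φ x z) := by
  obtain ⟨q₀, hq₀, hsupp⟩ := hQconv.exists_forall_pos hQne fun q hq => (hQ q hq).1
  set J := Real.log 2 * stateInfo V q₀ p with hJ
  have hJI : I ≤ J := hI q₀ hq₀
  set η := δ / (J - I + δ + 1) with hη
  have hden : 0 < J - I + δ + 1 := by linarith
  have hη0 : 0 < η := div_pos hδ hden
  have hη1 : η < 1 := (div_lt_one hden).2 (by linarith)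
  have hηδ : η * (J - I + δ + 1) = δ := by rw [hη]; field_simp
  have hη1' : 0 < 1 - η := sub_pos.2 hη1
  have hc : Continuous fun q => stateInfo V ((1 - η) • q + η • q₀) p :=
    Continuous.comp (g := fun qp : (𝒮 → ℝ) × (𝒳 → ℝ) => stateInfo V qp.1 qp.2)
      (f := fun q => ((1 - η) • q + η • q₀, p)) (continuous_stateInfo V) (by fun_prop)
  obtain ⟨q₁, hq₁, hmin⟩ := hQcomp.exists_isMinOn hQne hc.continuousOn
  have hmix : ∀ q ∈ Q, (1 - η) • q + η • q₀ ∈ Q := fun q hq =>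
    hQconv hq hq₀ hη1'.le hη0.le (by ring)
  set r := (1 - η) • q₁ + η • q₀ with hr
  have hrQ : r ∈ Q := hmix q₁ hq₁
  have hK : ∀ q ∈ Q, ∀ x, IsPMF (stateAvg V q x) := fun q hq => hV.stateAvg_isPMF (hQ q hq)
  have hsuppV : ∀ q ∈ Q, ∀ x z, stateAvg V q x z ≠ 0 → stateAvg V r x z ≠ 0 := by
    intro q hq x z h
    obtain ⟨s, -, hs⟩ := Finset.exists_ne_zero_of_sum_ne_zero h
    have h1 : 0 < q s := ((hQ q hq).1 s).lt_of_ne' (left_ne_zero_of_mul hs)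
    have h2 : 0 < V x s z := ((hV x s).1 z).lt_of_ne' (right_ne_zero_of_mul hs)
    have h3 : 0 < stateAvg V q₀ x z := (mul_pos (hsupp q hq s h1) h2).trans_le
      (Finset.single_le_sum (f := fun s => q₀ s * V x s z)
        (fun i _ => mul_nonneg ((hQ q₀ hq₀).1 i) ((hV x i).1 z)) (Finset.mem_univ s))
    have h4 := (hK q₁ hq₁ x).1 z
    rw [hr, stateAvg_combo]
    positivity
  refine ⟨infoRatio p (stateAvg V r), infoRatio_nonneg hp (hK r hrQ),
    sum_mul_infoRatio_le_one p _, fun q hq x z h => infoRatio_pos hp (hK r hrQ)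
      (mul_ne_zero (left_ne_zero_of_mul h) (hsuppV q hq x z (right_ne_zero_of_mul h))),
    fun q hq => ?_⟩
  have e1 := le_sum_mul_log_infoRatio hV hp (hQ r hrQ) (hQ _ (hmix q hq))
    (fun x z h => hsuppV _ (hmix q hq) x z (right_ne_zero_of_mul h)) fun t ht => by
      have hconv := hQconv hq₁ hq (sub_nonneg.2 ht.2.le) ht.1.le (by ring)
      have e : (1 - t) • r + t • ((1 - η) • q + η • q₀)
          = (1 - η) • ((1 - t) • q₁ + t • q) + η • q₀ := by
        module
      rw [e]
      exact hmin hconv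
  have e2 := sum_mul_log_infoRatio_le hp (hK q₀ hq₀) (hK r hrQ)
    fun x z h => hsuppV q₀ hq₀ x z (right_ne_zero_of_mul h)
  have e3 : ∑ x, ∑ z, p x * stateAvg V ((1 - η) • q + η • q₀) x z
        * Real.log (infoRatio p (stateAvg V r) x z)
      = (1 - η) * (∑ x, ∑ z, p x * stateAvg V q x z * Real.log (infoRatio p (stateAvg V r) x z))
        + η * ∑ x, ∑ z, p x * stateAvg V q₀ x z * Real.log (infoRatio p (stateAvg V r) x z) := by
    simp only [Finset.mul_sum, ← Finset.sum_add_distrib]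
    refine Finset.sum_congr rfl fun x _ => Finset.sum_congr rfl fun z _ => ?_
    rw [stateAvg_combo V q q₀ (1 - η) η x z]
    ring
  rw [e3] at e1
  have e4 := mul_le_mul_of_nonneg_left e2 hη0.le
  have e5 := hI r hrQ
  refine le_of_mul_le_mul_left ?_ hη1'
  simp only [hJ, stateInfo] at e4 hηδ e5 e1 ⊢
  linarith

end Metric

/-! ### Random coding -/

lemma sum_prod_apply_mul_apply_mul {ι A : Type} [Fintype ι] [DecidableEq ι] [Fintype A]
    {π : A → ℝ} (hπ : ∑ a, π a = 1) (F G : A → ℝ) {i j : ι} (hij : i ≠ j) :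
    ∑ c : ι → A, (∏ k, π (c k)) * (F (c i) * G (c j)) = (∑ a, π a * F a) * ∑ a, π a * G a := by
  have h : ∀ c : ι → A, (∏ k, π (c k)) * (F (c i) * G (c j))
      = ∏ k, π (c k) * ((if k = i then F (c k) else 1) * (if k = j then G (c k) else 1)) := by
    intro c
    simp only [Finset.prod_mul_distrib]
    rw [Finset.prod_ite_eq' Finset.univ i, Finset.prod_ite_eq' Finset.univ j]
    simp
  simp only [h]
  rw [← Fintype.prod_sum fun k a =>
      π a * ((if k = i then F a else 1) * (if k = j then G a else 1)),
    ← Finset.mul_prod_erase Finset.univ _ (Finset.mem_univ i),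
    ← Finset.mul_prod_erase (Finset.univ.erase i) _
      (Finset.mem_erase.2 ⟨hij.symm, Finset.mem_univ j⟩),
    Finset.prod_eq_one fun k hk => ?_]
  · simp [hij, hij.symm]
  · simp only [Finset.mem_erase] at hk
    simp [hk.1, hk.2.1, hπ]

/-- A threshold decoder: it can only err if the sent message is rejected or another message is
accepted. -/
lemma exists_decoder {Z : Type} {M : ℕ} (hM : 0 < M) (good : Fin M → Z → Prop) :
    ∃ g : Z → Fin M, ∀ z m, g z ≠ m → ¬ good m z ∨ ∃ m' ≠ m, good m' z := by
  classical
  refine ⟨fun z => if h : ∃ m, good m z then h.choose else ⟨0, hM⟩, fun z m hne => ?_⟩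
  by_cases hm : good m z
  · have hex : ∃ m, good m z := ⟨m, hm⟩
    simp only [dif_pos hex] at hne
    exact Or.inr ⟨_, hne, hex.choose_spec⟩
  · exact Or.inl hm

/-- Shannon's one-shot random coding bound for threshold decoding. -/
lemma sum_codebook_error_le {A Z : Type} [Fintype A] [Fintype Z] {π : A → ℝ} (hπ : IsPMF π)
    {K : A → Z → ℝ} (hK : ∀ a, IsPMF (K a)) {M : ℕ} (hM : 0 < M) (good : A → Z → Prop)
    [∀ a z, Decidable (good a z)] (g : (Fin M → A) → Z → Fin M)
    (hg : ∀ c z m, g c z ≠ m → ¬ good (c m) z ∨ ∃ m' ≠ m, good (c m') z)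
    {α β : ℝ} (hα : ∑ a, π a * ∑ z, (if good a z then 0 else K a z) ≤ α)
    (hβ : ∀ z, ∑ a, π a * (if good a z then 1 else 0) ≤ β) :
    ∑ c : Fin M → A, (∏ m, π (c m)) *
      ((M : ℝ)⁻¹ * ∑ m, ∑ z, if g c z = m then 0 else K (c m) z) ≤ α + M * β := by
  have hM0 : (0 : ℝ) < M := Nat.cast_pos.2 hM
  have hpt : ∀ (c : Fin M → A) m z, (if g c z = m then 0 else K (c m) z)
      ≤ (if good (c m) z then 0 else K (c m) z)
        + ∑ m' ∈ Finset.univ.erase m, K (c m) z * (if good (c m') z then 1 else 0) := by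
    intro c m z
    have hk := (hK (c m)).1 z
    have hnn : ∀ m' ∈ Finset.univ.erase m, 0 ≤ K (c m) z * (if good (c m') z then (1 : ℝ) else 0) :=
      fun m' _ => by split_ifs <;> simp [hk]
    have hs := Finset.sum_nonneg hnn
    have hf : 0 ≤ if good (c m) z then 0 else K (c m) z := by split_ifs <;> simp [hk]
    by_cases h : g c z = m
    · rw [if_pos h]
      linarith
    · rw [if_neg h]
      rcases hg c z m h with h1 | ⟨m', hne, h1⟩
      · rw [if_neg h1]
        linarith
      · have := Finset.single_le_sum hnn (Finset.mem_erase.2 ⟨hne, Finset.mem_univ m'⟩)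
        rw [if_pos h1, mul_one] at this
        linarith
  have hmsg : ∀ m, ∑ c : Fin M → A, (∏ j, π (c j)) *
      ∑ z, (if g c z = m then 0 else K (c m) z) ≤ α + M * β := by
    intro m
    have hcross : ∀ m' ∈ Finset.univ.erase m, ∑ c : Fin M → A, (∏ j, π (c j)) *
        ∑ z, K (c m) z * (if good (c m') z then 1 else 0) ≤ β := by
      intro m' hm'
      have hne : m ≠ m' := (Finset.ne_of_mem_erase hm').symm
      simp only [Finset.mul_sum]
      rw [Finset.sum_comm]
      simp only [fun z => sum_prod_apply_mul_apply_mul hπ.2 (fun a => K a z)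
        (fun a => if good a z then (1 : ℝ) else 0) hne]
      calc _ ≤ ∑ z, (∑ a, π a * K a z) * β := by
            refine Finset.sum_le_sum fun z _ => mul_le_mul_of_nonneg_left (hβ z)
              (Finset.sum_nonneg fun a _ => mul_nonneg (hπ.1 a) ((hK a).1 z))
        _ = β := by
            rw [← Finset.sum_mul, Finset.sum_comm]
            simp only [← Finset.mul_sum, (hK _).2, mul_one, hπ.2, one_mul]
    have hβ0 : 0 ≤ β := by
      by_cases hZ : Nonempty Z
      · obtain ⟨z⟩ := hZ
        exact (Finset.sum_nonneg fun a _ => mul_nonneg (hπ.1 a) (by split_ifs <;> simp)).trans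
          (hβ z)
      · obtain ⟨a, -, -⟩ := Finset.exists_ne_zero_of_sum_ne_zero (hπ.2.trans_ne one_ne_zero)
        obtain ⟨z, -, -⟩ := Finset.exists_ne_zero_of_sum_ne_zero ((hK a).2.trans_ne one_ne_zero)
        exact absurd ⟨z⟩ hZ
    calc _ ≤ ∑ c : Fin M → A, (∏ j, π (c j)) *
          ∑ z, ((if good (c m) z then 0 else K (c m) z)
            + ∑ m' ∈ Finset.univ.erase m, K (c m) z * (if good (c m') z then 1 else 0)) := by
          refine Finset.sum_le_sum fun c _ => mul_le_mul_of_nonneg_left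
            (Finset.sum_le_sum fun z _ => hpt c m z) (Finset.prod_nonneg fun j _ => hπ.1 _)
      _ = ∑ c : Fin M → A, (∏ j, π (c j)) * ∑ z, (if good (c m) z then 0 else K (c m) z)
          + ∑ m' ∈ Finset.univ.erase m, ∑ c : Fin M → A, (∏ j, π (c j)) *
            ∑ z, K (c m) z * (if good (c m') z then 1 else 0) := by
          rw [Finset.sum_comm (s := Finset.univ.erase m), ← Finset.sum_add_distrib]
          refine Finset.sum_congr rfl fun c _ => ?_
          rw [← Finset.mul_sum, Finset.sum_add_distrib, mul_add,
            Finset.sum_comm (s := Finset.univ.erase m)]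
      _ ≤ α + ∑ m' ∈ Finset.univ.erase m, β := by
          gcongr with m' hm'
          · rw [sum_prod_apply_mul (fun _ => hπ.2)
              (fun a => ∑ z, if good a z then 0 else K a z) m]
            exact hα
          · exact hcross m' hm'
      _ ≤ α + M * β := by
          rw [Finset.sum_const, nsmul_eq_mul]
          gcongr
          exact (Finset.card_le_univ _).trans_eq (Fintype.card_fin M)
  calc _ = (M : ℝ)⁻¹ * ∑ m, ∑ c : Fin M → A, (∏ j, π (c j)) *
        ∑ z, (if g c z = m then 0 else K (c m) z) := by
        rw [Finset.sum_comm, Finset.mul_sum]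
        refine Finset.sum_congr rfl fun c _ => ?_
        rw [← Finset.mul_sum]
        ring
    _ ≤ (M : ℝ)⁻¹ * ∑ _m : Fin M, (α + M * β) := by
        gcongr with m
        exact hmsg m
    _ = α + M * β := by
        rw [Finset.sum_const, Finset.card_univ, Fintype.card_fin, nsmul_eq_mul,
          inv_mul_cancel_left₀ hM0.ne']

/-- A Chernoff bound for a bounded information density. -/
lemma sum_mul_exp_le {𝒳 𝒵 : Type} [Fintype 𝒳] [Fintype 𝒵] {p : 𝒳 → ℝ} (hp : IsPMF p)
    {K : 𝒳 → 𝒵 → ℝ} (hK : ∀ x, IsPMF (K x)) {u : 𝒳 → 𝒵 → ℝ} {d B : ℝ} (hd : 0 < d) (hdB : d ≤ B)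
    (hu : ∀ x z, |u x z| ≤ B) (hmean : ∑ x, ∑ z, p x * K x z * u x z ≤ -d) :
    ∑ x, ∑ z, p x * K x z * Real.exp (d / (2 * B ^ 2) * u x z)
      ≤ Real.exp (-(d ^ 2 / (4 * B ^ 2))) := by
  have hB : 0 < B := hd.trans_le hdB
  set l := d / (2 * B ^ 2) with hl
  have hl0 : 0 < l := by positivity
  have hlB : l * B ≤ 1 := by
    rw [hl, div_mul_eq_mul_div, div_le_one (by positivity)]
    nlinarith
  have hpt : ∀ x z, p x * K x z * Real.exp (l * u x z)
      ≤ p x * K x z * (1 + l ^ 2 * B ^ 2) + l * (p x * K x z * u x z) := by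
    intro x z
    have h0 : 0 ≤ p x * K x z := mul_nonneg (hp.1 x) ((hK x).1 z)
    have h1 : |l * u x z| ≤ l * B := by
      rw [abs_mul, abs_of_pos hl0]
      exact mul_le_mul_of_nonneg_left (hu x z) hl0.le
    have h2 := (abs_le.1 (Real.abs_exp_sub_one_sub_id_le (h1.trans hlB))).2
    have h3 : (l * u x z) ^ 2 ≤ (l * B) ^ 2 := sq_le_sq' (by linarith [(abs_le.1 h1).1])
      (abs_le.1 h1).2
    have h4 : Real.exp (l * u x z) ≤ 1 + l ^ 2 * B ^ 2 + l * u x z := by linarith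
    linarith [mul_le_mul_of_nonneg_left h4 h0]
  calc _ ≤ ∑ x, ∑ z, (p x * K x z * (1 + l ^ 2 * B ^ 2) + l * (p x * K x z * u x z)) :=
        Finset.sum_le_sum fun x _ => Finset.sum_le_sum fun z _ => hpt x z
    _ = (1 + l ^ 2 * B ^ 2) + l * ∑ x, ∑ z, p x * K x z * u x z := by
        simp only [Finset.sum_add_distrib, ← Finset.sum_mul, ← Finset.mul_sum, (hK _).2, hp.2,
          mul_one, one_mul]
    _ ≤ (1 + l ^ 2 * B ^ 2) + l * -d := by gcongr
    _ = -(d ^ 2 / (4 * B ^ 2)) + 1 := by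
        rw [hl]
        field_simp
        ring
    _ ≤ _ := Real.add_one_le_exp _

/-- The probability that the sent codeword is rejected by the threshold test. -/
lemma sum_reject_le {𝒳 𝒵 : Type} [Fintype 𝒳] [Fintype 𝒵] {p : 𝒳 → ℝ} {φ : 𝒳 → 𝒵 → ℝ}
    (hp : IsPMF p) {K : 𝒳 → 𝒵 → ℝ} (hK : ∀ x, IsPMF (K x))
    (hφpos : ∀ x z, p x * K x z ≠ 0 → 0 < φ x z) {l τ κ : ℝ} (hl : 0 ≤ l)
    (hκ : ∑ x, ∑ z, p x * K x z * Real.exp (l * (τ - Real.log (φ x z))) ≤ Real.exp (-κ)) (n : ℕ) :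
    ∑ x : Fin n → 𝒳, (∏ i, p (x i)) * ∑ z : Fin n → 𝒵,
      (if Real.exp (n * τ) ≤ ∏ i, φ (x i) (z i) then 0 else ∏ i, K (x i) (z i))
      ≤ Real.exp (-(n * κ)) := by
  have hpt : ∀ (x : Fin n → 𝒳) (z : Fin n → 𝒵), (∏ i, p (x i)) *
      (if Real.exp (n * τ) ≤ ∏ i, φ (x i) (z i) then 0 else ∏ i, K (x i) (z i))
      ≤ ∏ i, p (x i) * K (x i) (z i) * Real.exp (l * (τ - Real.log (φ (x i) (z i)))) := by
    intro x z
    have hnn : ∀ i, 0 ≤ p (x i) * K (x i) (z i) := fun i => mul_nonneg (hp.1 _) ((hK _).1 _)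
    have hR : 0 ≤ ∏ i, p (x i) * K (x i) (z i) * Real.exp (l * (τ - Real.log (φ (x i) (z i)))) :=
      Finset.prod_nonneg fun i _ => mul_nonneg (hnn i) (Real.exp_pos _).le
    split_ifs with h
    · rwa [mul_zero]
    rw [← Finset.prod_mul_distrib]
    by_cases h0 : ∏ i, p (x i) * K (x i) (z i) = 0
    · rwa [h0]
    rw [← ne_eq, Finset.prod_ne_zero_iff] at h0
    have hφ : ∀ i, 0 < φ (x i) (z i) := fun i => hφpos _ _ (h0 i (Finset.mem_univ i))
    rw [Finset.prod_mul_distrib (f := fun i => p (x i) * K (x i) (z i)), ← Real.exp_sum]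
    refine le_mul_of_one_le_right (Finset.prod_nonneg fun i _ => hnn i) (Real.one_le_exp ?_)
    rw [← Finset.mul_sum, Finset.sum_sub_distrib, ← Real.log_prod fun i _ => (hφ i).ne']
    refine mul_nonneg hl (sub_nonneg.2 ?_)
    have := Real.log_le_log (Finset.prod_pos fun i _ => hφ i) (not_le.1 h).le
    simpa using this
  calc _ ≤ ∑ x : Fin n → 𝒳, ∑ z : Fin n → 𝒵,
        ∏ i, p (x i) * K (x i) (z i) * Real.exp (l * (τ - Real.log (φ (x i) (z i)))) := by
        refine Finset.sum_le_sum fun x _ => ?_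
        rw [Finset.mul_sum]
        exact Finset.sum_le_sum fun z _ => hpt x z
    _ = (∑ x, ∑ z, p x * K x z * Real.exp (l * (τ - Real.log (φ x z)))) ^ n := by
        rw [Finset.sum_congr rfl fun x _ => (Fintype.prod_sum fun i w => p (x i) * K (x i) w *
          Real.exp (l * (τ - Real.log (φ (x i) w)))).symm]
        rw [← Fintype.prod_sum fun (_ : Fin n) x =>
          ∑ w, p x * K x w * Real.exp (l * (τ - Real.log (φ x w)))]
        simp
    _ ≤ Real.exp (-κ) ^ n := by
        gcongr
        exact Finset.sum_nonneg fun x _ => Finset.sum_nonneg fun z _ =>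
          mul_nonneg (mul_nonneg (hp.1 x) ((hK x).1 z)) (Real.exp_pos _).le
    _ = _ := by
        rw [← Real.exp_nat_mul]
        ring_nf

/-- The probability that an independent codeword is accepted by the threshold test. -/
lemma sum_accept_le {𝒳 𝒵 : Type} [Fintype 𝒳] {p : 𝒳 → ℝ} {φ : 𝒳 → 𝒵 → ℝ}
    (hp : IsPMF p) (hφ : ∀ x z, 0 ≤ φ x z) (hφ1 : ∀ z, ∑ x, p x * φ x z ≤ 1)
    (τ : ℝ) {n : ℕ} (z : Fin n → 𝒵) :
    ∑ x : Fin n → 𝒳, (∏ i, p (x i)) *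
      (if Real.exp (n * τ) ≤ ∏ i, φ (x i) (z i) then 1 else 0) ≤ Real.exp (-(n * τ)) := by
  have hpt : ∀ x : Fin n → 𝒳, (∏ i, p (x i)) *
      (if Real.exp (n * τ) ≤ ∏ i, φ (x i) (z i) then 1 else 0)
      ≤ Real.exp (-(n * τ)) * ∏ i, p (x i) * φ (x i) (z i) := by
    intro x
    have h1 : 0 ≤ ∏ i, p (x i) := Finset.prod_nonneg fun i _ => hp.1 _
    have h2 : 0 ≤ ∏ i, φ (x i) (z i) := Finset.prod_nonneg fun i _ => hφ _ _
    rw [Finset.prod_mul_distrib, mul_left_comm]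
    refine mul_le_mul_of_nonneg_left ?_ h1
    split_ifs with h
    · rw [Real.exp_neg, inv_mul_eq_div]
      exact (one_le_div (Real.exp_pos _)).2 h
    · positivity
  refine (Finset.sum_le_sum fun x _ => hpt x).trans ?_
  rw [← Finset.mul_sum, ← Fintype.prod_sum fun i x => p x * φ x (z i)]
  exact mul_le_of_le_one_right (Real.exp_pos _).le (Finset.prod_le_one
    (fun i _ => Finset.sum_nonneg fun x _ => mul_nonneg (hp.1 x) (hφ _ _)) fun i _ => hφ1 _)

/-- The memoryless laws from a compact set are dominated by a sum of polynomially many of them,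
indexed by types. -/
lemma exists_prod_le_sum_types {𝒮 : Type} [Fintype 𝒮] [DecidableEq 𝒮] {Q : Set (𝒮 → ℝ)}
    (hQ : ∀ q ∈ Q, ∀ s, 0 ≤ q s) (hQne : Q.Nonempty) (hQcomp : IsCompact Q) (n : ℕ) :
    ∃ r : (𝒮 → Fin (n + 1)) → 𝒮 → ℝ, (∀ T, r T ∈ Q) ∧
      ∀ q ∈ Q, ∀ s : Fin n → 𝒮, ∏ i, q (s i) ≤ ∑ T, ∏ i, r T (s i) := by
  have h : ∀ T : 𝒮 → Fin (n + 1), ∃ q₀ ∈ Q, ∀ q ∈ Q,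
      ∏ a, q a ^ (T a : ℕ) ≤ ∏ a, q₀ a ^ (T a : ℕ) := fun T => by
    obtain ⟨q₀, hq₀, hmax⟩ := hQcomp.exists_isMaxOn hQne
      (f := fun q : 𝒮 → ℝ => ∏ a, q a ^ (T a : ℕ)) (by fun_prop)
    exact ⟨q₀, hq₀, fun q hq => hmax hq⟩
  choose r hrQ hr using h
  refine ⟨r, hrQ, fun q hq s => ?_⟩
  have hcount : ∀ q' : 𝒮 → ℝ, ∏ i, q' (s i) = ∏ a, q' a ^ (Finset.univ.filter (s · = a)).card :=
    fun q' => by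
      rw [← Finset.prod_fiberwise Finset.univ s]
      refine Finset.prod_congr rfl fun a _ => Finset.prod_eq_pow_card fun i hi => ?_
      rw [(Finset.mem_filter.1 hi).2]
  have hT := hr (fun a => ⟨(Finset.univ.filter (s · = a)).card,
    Nat.lt_succ_of_le ((Finset.card_le_univ _).trans_eq (Fintype.card_fin n))⟩) q hq
  simp only [← hcount] at hT
  exact hT.trans (Finset.single_le_sum (f := fun T => ∏ i, r T (s i))
    (fun T _ => Finset.prod_nonneg fun i _ => hQ _ (hrQ T) _) (Finset.mem_univ _))

/-! ### Achievability -/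

lemma PCode.errGiven_nonneg {𝒳 𝒮 𝒴 𝒴₁ : Type} [Fintype 𝒴] [Fintype 𝒴₁] {n M L : ℕ}
    (C : PCode 𝒳 𝒴 𝒴₁ n M L) {W : 𝒳 → 𝒮 → 𝒴 × 𝒴₁ → ℝ}
    (hW : IsChannel W) (s : Fin n → 𝒮) : 0 ≤ C.errGiven W s := by
  refine mul_nonneg (by positivity) (Finset.sum_nonneg fun m _ => Finset.sum_nonneg fun y _ =>
    Finset.sum_nonneg fun y1 _ => ?_)
  split_ifs
  · exact le_rfl
  · exact Finset.prod_nonneg fun i _ => (hW _ _).1 _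

/-- The random coding bound for an i.i.d. codebook decoded by thresholding a product metric. -/
lemma sum_iid_codebook_error_le {𝒳 𝒵 : Type} [Fintype 𝒳] [Fintype 𝒵] {p : 𝒳 → ℝ}
    {φ : 𝒳 → 𝒵 → ℝ} (hp : IsPMF p) {K : 𝒳 → 𝒵 → ℝ} (hK : ∀ x, IsPMF (K x))
    (hφ : ∀ x z, 0 ≤ φ x z) (hφ1 : ∀ z, ∑ x, p x * φ x z ≤ 1)
    (hφpos : ∀ x z, p x * K x z ≠ 0 → 0 < φ x z) {l τ κ : ℝ} (hl : 0 ≤ l)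
    (hκ : ∑ x, ∑ z, p x * K x z * Real.exp (l * (τ - Real.log (φ x z))) ≤ Real.exp (-κ))
    {n M : ℕ} (hM : 0 < M) (g : (Fin M → Fin n → 𝒳) → (Fin n → 𝒵) → Fin M)
    (hg : ∀ c z m, g c z ≠ m → ¬ Real.exp (n * τ) ≤ ∏ i, φ (c m i) (z i) ∨
      ∃ m' ≠ m, Real.exp (n * τ) ≤ ∏ i, φ (c m' i) (z i)) :
    ∑ c : Fin M → Fin n → 𝒳, (∏ m, ∏ i, p (c m i)) * ((M : ℝ)⁻¹ * ∑ m, ∑ z : Fin n → 𝒵,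
      if g c z = m then 0 else ∏ i, K (c m i) (z i))
      ≤ Real.exp (-(n * κ)) + M * Real.exp (-(n * τ)) :=
  sum_codebook_error_le
    (π := fun x : Fin n → 𝒳 => ∏ i, p (x i)) (K := fun x (z : Fin n → 𝒵) => ∏ i, K (x i) (z i))
    ⟨fun _ => Finset.prod_nonneg fun _ _ => hp.1 _, sum_prod_apply_eq_one fun _ => hp.2⟩
    (fun _ => ⟨fun _ => Finset.prod_nonneg fun _ _ => (hK _).1 _,
      sum_prod_apply_eq_one fun _ => (hK _).2⟩) hM
    (fun x z => Real.exp (n * τ) ≤ ∏ i, φ (x i) (z i)) g hg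
    (sum_reject_le hp hK hφpos hl hκ n) (sum_accept_le hp hφ hφ1 τ)

/-- A single code, ignoring the relay, is good for all states in `Q` at once. -/
lemma exists_code {𝒳 𝒮 𝒴 𝒴₁ : Type} [Fintype 𝒳] [Fintype 𝒮] [Fintype 𝒴] [Fintype 𝒴₁]
    {W : 𝒳 → 𝒮 → 𝒴 × 𝒴₁ → ℝ} (hW : IsChannel W) {Q : Set (𝒮 → ℝ)}
    (hQ : ∀ q ∈ Q, IsPMF q) (hQne : Q.Nonempty) (hQcomp : IsCompact Q) {p : 𝒳 → ℝ} (hp : IsPMF p)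
    {φ : 𝒳 → 𝒴 → ℝ} (hφ : ∀ x y, 0 ≤ φ x y) (hφ1 : ∀ y, ∑ x, p x * φ x y ≤ 1)
    (hφpos : ∀ q ∈ Q, ∀ x z, p x * stateAvg W q x z ≠ 0 → 0 < φ x z.1)
    {l τ κ : ℝ} (hl : 0 ≤ l)
    (hκ : ∀ q ∈ Q, ∑ x, ∑ z, p x * stateAvg W q x z * Real.exp (l * (τ - Real.log (φ x z.1)))
      ≤ Real.exp (-κ)) (n : ℕ) {M : ℕ} (hM : 0 < M) :
    ∃ C : PCode 𝒳 𝒴 𝒴₁ n M 1, ∀ q ∈ Q, C.errIID W q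
      ≤ (n + 1) ^ Fintype.card 𝒮 * (Real.exp (-(n * κ)) + M * Real.exp (-(n * τ))) := by
  classical
  obtain ⟨r, hrQ, hr⟩ := exists_prod_le_sum_types (fun q hq => (hQ q hq).1) hQne hQcomp n
  choose g hg using fun c : Fin M → Fin n → 𝒳 => exists_decoder hM
    fun m (y : Fin n → 𝒴) => Real.exp (n * τ) ≤ ∏ i, φ (c m i) (y i)
  let code : (Fin M → Fin n → 𝒳) → PCode 𝒳 𝒴 𝒴₁ n M 1 := fun c =>
    ⟨c, fun _ => 0, fun y => g c y.1⟩
  have hπ : IsPMF fun x : Fin n → 𝒳 => ∏ i, p (x i) :=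
    ⟨fun x => Finset.prod_nonneg fun i _ => hp.1 _, sum_prod_apply_eq_one fun _ => hp.2⟩
  obtain ⟨β, hβ⟩ : ∃ β, β = Real.exp (-(n * κ)) + M * Real.exp (-(n * τ)) := ⟨_, rfl⟩
  rw [← hβ]
  have hT : ∀ T, ∑ c : Fin M → Fin n → 𝒳, (∏ m, ∏ i, p (c m i)) * (code c).errIID W (r T) ≤ β := by
    intro T
    rw [hβ]
    simp only [PCode.errIID_eq]
    exact sum_iid_codebook_error_le (φ := fun x (z : 𝒴 × 𝒴₁) => φ x z.1) hp
      (hW.stateAvg_isPMF (hQ _ (hrQ T))) (fun x z => hφ x z.1) (fun z => hφ1 z.1)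
      (hφpos _ (hrQ T)) hl (hκ _ (hrQ T)) hM (fun c z => g c fun i => (z i).1)
      fun c z m => hg c _ m
  have hcard : Fintype.card (𝒮 → Fin (n + 1)) * β = (n + 1) ^ Fintype.card 𝒮 * β := by
    simp
  have hsum : ∑ c : Fin M → Fin n → 𝒳, (∏ m, ∏ i, p (c m i)) * ∑ T, (code c).errIID W (r T)
      ≤ ∑ c : Fin M → Fin n → 𝒳, (∏ m, ∏ i, p (c m i)) * ((n + 1) ^ Fintype.card 𝒮 * β) := by
    rw [← Finset.sum_mul, sum_prod_apply_eq_one (f := fun (_ : Fin M) (x : Fin n → 𝒳) => ∏ i, p (x i)) fun _ => hπ.2,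
      one_mul, ← hcard]
    simp only [Finset.mul_sum]
    rw [Finset.sum_comm]
    refine (Finset.sum_le_sum fun T _ => hT T).trans_eq ?_
    simp
  have hex : ∃ c, ∑ T, (code c).errIID W (r T) ≤ (n + 1) ^ Fintype.card 𝒮 * β := by
    by_contra! hlt
    obtain ⟨c, -, hc⟩ := Finset.exists_ne_zero_of_sum_ne_zero
      ((sum_prod_apply_eq_one (ι := Fin M) (f := fun (_ : Fin M) (x : Fin n → 𝒳) => ∏ i, p (x i))
        fun _ => hπ.2).trans_ne one_ne_zero)
    have hw : ∀ c : Fin M → Fin n → 𝒳, 0 ≤ ∏ m, ∏ i, p (c m i) := fun c =>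
      Finset.prod_nonneg fun m _ => hπ.1 _
    refine hsum.not_gt (Finset.sum_lt_sum
      (fun c _ => mul_le_mul_of_nonneg_left (hlt c).le (hw c)) ⟨c, Finset.mem_univ c, ?_⟩)
    exact mul_lt_mul_of_pos_left (hlt c) ((hw c).lt_of_ne' hc)
  obtain ⟨c, hc⟩ := hex
  refine ⟨code c, fun q hq => le_trans ?_ hc⟩
  simp only [PCode.errIID]
  rw [Finset.sum_comm]
  refine Finset.sum_le_sum fun s _ => ?_
  rw [← Finset.sum_mul]
  exact mul_le_mul_of_nonneg_right (hr q hq s) ((code c).errGiven_nonneg hW s)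

lemma tendsto_polynomial_mul_exp (k : ℕ) {a : ℝ} (ha : 0 < a) :
    Filter.Tendsto (fun n : ℕ => ((n : ℝ) + 1) ^ k * Real.exp (-(n * a))) Filter.atTop (nhds 0) := by
  have h := (tendsto_pow_const_mul_const_pow_of_abs_lt_one k (r := Real.exp (-a))
    (by rw [abs_of_pos (Real.exp_pos _)]; exact Real.exp_lt_one_iff.2 (neg_lt_zero.2 ha))).comp
    (Filter.tendsto_add_atTop_nat 1)
  have h2 := h.const_mul (Real.exp a)
  rw [mul_zero] at h2
  refine h2.congr fun n => ?_
  simp only [Function.comp_apply]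
  rw [← Real.exp_nat_mul, mul_left_comm, ← Real.exp_add]
  push_cast
  ring_nf

lemma linkOK_one (n : ℕ) {C1 : ℝ} (hC1 : 0 ≤ C1) : LinkOK n 1 C1 :=
  ⟨le_rfl, by simpa using Real.one_le_rpow one_le_two (by positivity : 0 ≤ (n : ℝ) * C1)⟩

lemma compAchievable_zero {𝒳 𝒮 𝒴 𝒴₁ : Type} [Fintype 𝒮] [Fintype 𝒴] [Fintype 𝒴₁]
    [Nonempty 𝒳] (W : 𝒳 → 𝒮 → 𝒴 × 𝒴₁ → ℝ) {C1 : ℝ} (hC1 : 0 ≤ C1)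
    (Q : Set (𝒮 → ℝ)) : CompAchievable W C1 Q 0 := by
  refine fun ε hε => ⟨0, fun n _ => ⟨1, 1, ⟨fun _ _ => Classical.arbitrary 𝒳, fun _ => 0,
    fun _ => 0⟩, by simp, linkOK_one n hC1, fun q _ => ?_⟩⟩
  simpa [PCode.errIID, PCode.errGiven, Fin.eq_zero] using hε.le

/-- Every rate below the least information between input and receiver output is achievable. -/
lemma compAchievable_of_lt {𝒳 𝒮 𝒴 𝒴₁ : Type} [Fintype 𝒳] [Fintype 𝒮] [Fintype 𝒴] [Fintype 𝒴₁]
    {W : 𝒳 → 𝒮 → 𝒴 × 𝒴₁ → ℝ} (hW : IsChannel W) {WY : 𝒳 → 𝒮 → 𝒴 → ℝ}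
    {V : 𝒴 → 𝒴₁ → ℝ} (hWY : IsChannel WY) (hV : ∀ y, IsPMF (V y))
    (hdeg : ∀ x s y y1, W x s (y, y1) = WY x s y * V y y1) {C1 : ℝ} (hC1 : 0 ≤ C1)
    {Q : Set (𝒮 → ℝ)} (hQ : ∀ q ∈ Q, IsPMF q) (hQne : Q.Nonempty) (hQcomp : IsCompact Q)
    (hQconv : Convex ℝ Q) {p : 𝒳 → ℝ} (hp : IsPMF p) {T R : ℝ}
    (hT : ∀ q ∈ Q, T ≤ stateInfo WY q p) (hR : 0 ≤ R) (hRT : R < T) :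
    CompAchievable W C1 Q R := by
  have hl2 : 0 < Real.log 2 := Real.log_pos one_lt_two
  set d := Real.log 2 * (T - R) / 4 with hd
  have hd0 : 0 < d := by
    have := sub_pos.2 hRT
    positivity
  obtain ⟨φ, hφ, hφ1, hφpos, hφmean⟩ := exists_metric hWY hp hQ hQne hQcomp hQconv
    (fun q hq => mul_le_mul_of_nonneg_left (hT q hq) hl2.le) hd0
  set τ := Real.log 2 * R + 2 * d with hτ
  set u : 𝒳 → 𝒴 → ℝ := fun x y => τ - Real.log (φ x y) with hu
  set B := d + ∑ x, ∑ y, |u x y| with hB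
  have hsum0 : 0 ≤ ∑ x, ∑ y, |u x y| :=
    Finset.sum_nonneg fun x _ => Finset.sum_nonneg fun y _ => abs_nonneg _
  have hdB : d ≤ B := le_add_of_nonneg_right hsum0
  have huB : ∀ x y, |u x y| ≤ B := by
    intro x y
    have h1 := Finset.single_le_sum (f := fun y => |u x y|) (fun _ _ => abs_nonneg _)
      (Finset.mem_univ y)
    have h2 := Finset.single_le_sum (f := fun x => ∑ y, |u x y|)
      (fun _ _ => Finset.sum_nonneg fun _ _ => abs_nonneg _) (Finset.mem_univ x)
    linarith [h1.trans h2]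
  set κ := d ^ 2 / (4 * B ^ 2) with hκ
  have hB0 : 0 < B := hd0.trans_le hdB
  have hκ0 : 0 < κ := by positivity
  have havg : ∀ q x y y1, stateAvg W q x (y, y1) = stateAvg WY q x y * V y y1 := by
    intro q x y y1
    simp only [stateAvg, hdeg, Finset.sum_mul, mul_assoc]
  have hchern : ∀ q ∈ Q, ∑ x, ∑ y, p x * stateAvg WY q x y *
      Real.exp (d / (2 * B ^ 2) * u x y) ≤ Real.exp (-κ) := by
    intro q hq
    have hK := hWY.stateAvg_isPMF (hQ q hq)
    refine sum_mul_exp_le hp hK hd0 hdB huB ?_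
    have h1 := hφmean q hq
    have h2 : ∑ x, ∑ y, p x * stateAvg WY q x y * u x y
        = τ - ∑ x, ∑ y, p x * stateAvg WY q x y * Real.log (φ x y) := by
      simp only [hu, mul_sub, Finset.sum_sub_distrib, ← Finset.sum_mul, ← Finset.mul_sum,
        (hK _).2, mul_one, hp.2, one_mul]
    rw [h2]
    have h3 : Real.log 2 * T = Real.log 2 * R + 4 * d := by rw [hd]; ring
    linarith
  have hchern' : ∀ q ∈ Q, ∑ x, ∑ z : 𝒴 × 𝒴₁, p x * stateAvg W q x z *
      Real.exp (d / (2 * B ^ 2) * (τ - Real.log (φ x z.1))) ≤ Real.exp (-κ) := by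
    intro q hq
    refine le_of_eq_of_le (Finset.sum_congr rfl fun x _ => ?_) (hchern q hq)
    rw [Fintype.sum_prod_type]
    refine Finset.sum_congr rfl fun y _ => ?_
    calc _ = ∑ y1, p x * stateAvg WY q x y * Real.exp (d / (2 * B ^ 2) * u x y) * V y y1 :=
          Finset.sum_congr rfl fun y1 _ => by rw [havg]; ring
      _ = _ := by rw [← Finset.mul_sum, (hV y).2, mul_one]
  have hφpos' : ∀ q ∈ Q, ∀ x (z : 𝒴 × 𝒴₁), p x * stateAvg W q x z ≠ 0 → 0 < φ x z.1 :=
    fun q hq x z h => hφpos q hq x z.1 fun h0 => h (by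
      rw [havg q x z.1 z.2, ← mul_assoc, h0, zero_mul])
  have hlim := (tendsto_polynomial_mul_exp (Fintype.card 𝒮) hκ0).add
    ((tendsto_polynomial_mul_exp (Fintype.card 𝒮) (mul_pos two_pos hd0)).const_mul 2)
  rw [mul_zero, add_zero] at hlim
  intro ε hε
  obtain ⟨N, hN⟩ := Filter.eventually_atTop.1 (hlim.eventually_le_const hε)
  refine ⟨N, fun n hn => ?_⟩
  have hpow : 1 ≤ (2 : ℝ) ^ ((n : ℝ) * R) := Real.one_le_rpow one_le_two (by positivity)
  have hM : 0 < ⌈(2 : ℝ) ^ ((n : ℝ) * R)⌉₊ := Nat.ceil_pos.2 (by linarith)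
  obtain ⟨C, hC⟩ := exists_code hW hQ hQne hQcomp hp hφ hφ1 hφpos'
    (by positivity : 0 ≤ d / (2 * B ^ 2)) hchern' n hM
  refine ⟨_, 1, C, Nat.le_ceil _, linkOK_one n hC1, fun q hq => (hC q hq).trans ?_⟩
  refine le_trans ?_ (hN n hn)
  have hceil : (⌈(2 : ℝ) ^ ((n : ℝ) * R)⌉₊ : ℝ) ≤ 2 * (2 : ℝ) ^ ((n : ℝ) * R) := by
    linarith [(Nat.ceil_lt_add_one (by linarith : 0 ≤ (2 : ℝ) ^ ((n : ℝ) * R))).le]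
  have hexp : (2 : ℝ) ^ ((n : ℝ) * R) * Real.exp (-(n * τ)) = Real.exp (-(n * (2 * d))) := by
    rw [Real.rpow_def_of_pos two_pos, ← Real.exp_add, hτ]
    ring_nf
  calc _ ≤ ((n : ℝ) + 1) ^ Fintype.card 𝒮 * (Real.exp (-(n * κ))
        + 2 * (2 : ℝ) ^ ((n : ℝ) * R) * Real.exp (-(n * τ))) := by gcongr
    _ = _ := by
        rw [mul_assoc 2, hexp]
        ring

/-- For a reversely strongly degraded compound primitive relay channel with compact
convex state set `Q`, the deterministic code capacity, `R_DF(Q)` and `R_CS(Q)` all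
coincide and equal `min_{q∈Q} max_{p(x)} I_q(X;Y)`. -/
theorem compound_revStronglyDegraded_capacity
    {𝒳 𝒮 𝒴 𝒴₁ : Type} [Fintype 𝒳] [Fintype 𝒮] [Fintype 𝒴] [Fintype 𝒴₁] [Nonempty 𝒳]
    (W : 𝒳 → 𝒮 → 𝒴 × 𝒴₁ → ℝ) (hW : IsChannel W)
    (C1 : ℝ) (hC1 : 0 ≤ C1)
    (Q : Set (𝒮 → ℝ)) (hQ : ∀ q ∈ Q, IsPMF q) (hQne : Q.Nonempty)
    (hQcomp : IsCompact Q) (hQconv : Convex ℝ Q)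
    (hdeg : RevStronglyDegraded W) :
    CompCapacity W C1 Q
        = sInf {r | ∃ q ∈ Q, r = sSup {v | ∃ p : 𝒳 → ℝ, IsPMF p ∧ v = IqXY W p q}} ∧
    RDF W C1 Q
        = sInf {r | ∃ q ∈ Q, r = sSup {v | ∃ p : 𝒳 → ℝ, IsPMF p ∧ v = IqXY W p q}} ∧
    RCS W C1 Q
        = sInf {r | ∃ q ∈ Q, r = sSup {v | ∃ p : 𝒳 → ℝ, IsPMF p ∧ v = IqXY W p q}} := by
  obtain ⟨WY, V, hWY, hV, hWV⟩ := hdeg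
  obtain ⟨q₀, hq₀, p₀, hp₀, h⟩ := exists_saddle_stateInfo hWY hQ hQne hQcomp hQconv
  refine ⟨?_, ?_, RCS_eq hC1 hV hWV Q⟩
  all_goals simp only [IqXY_eq_stateInfo hV hWV]
  all_goals rw [sInf_sSup_eq_of_saddle hq₀ hp₀ h]
  · have hle : ∀ R, CompAchievable W C1 Q R → R ≤ stateInfo WY q₀ p₀ := fun R hR =>
      hR.le hW hq₀ (hQ q₀ hq₀) fun p hp =>
        (IqXYY1_eq_stateInfo hV hWV p q₀).trans_le (h q₀ hq₀ p hp)
    have h0 := compAchievable_zero W hC1 Q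
    refine le_antisymm (csSup_le ⟨0, h0⟩ hle) (le_of_forall_lt fun R hR => ?_)
    have hbdd : BddAbove {R | CompAchievable W C1 Q R} := ⟨_, hle⟩
    obtain ⟨R', hRR', hR'⟩ := exists_between hR
    refine hRR'.trans_le ?_
    rcases le_total 0 R' with hpos | hneg
    · exact le_csSup hbdd (compAchievable_of_lt hW hWY hV hWV hC1 hQ hQne hQcomp hQconv hp₀
        (fun q hq => h q hq p₀ hp₀) hpos hR')
    · exact hneg.trans (le_csSup hbdd h0)
  · exact RDF_eq hC1 hWY hV hWV hQ hQcomp hq₀ hp₀ h
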